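/- arXiv:1509.08723 — 3 statements merged into one kernel-verified Lean document; each statement's English description precedes it below -/
import Mathlib

section
/- For all x > 0 and real τ ≠ 0, the Bessel function of the first kind of purely imaginary order satisfies |J_{iτ}(x)| ≤ e^x · √(sinh(πτ)/(πτ)). -/
open Complex Real

/-- Bessel function of the first kind, defined by its power series. -/
noncomputable def besselJ (ν z : ℂ) : ℂ :=
  ∑' k : ℕ, ((-1 : ℂ) ^ k * (z / 2) ^ (2 * (k : ℂ) + ν)) /
    ((k.factorial : ℂ) * Complex.Gamma ((k : ℂ) + ν + 1))

/-- The norm of `Γ` at `1 + iτ`, in inverted form. -/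
theorem inv_norm_Gamma_one_add_I_mul (τ : ℝ) (hτ : τ ≠ 0) :
    ‖Complex.Gamma (Complex.I * τ + 1)‖⁻¹ = Real.sqrt (Real.sinh (π * τ) / (π * τ)) := by
  have hI : Complex.I * τ ≠ 0 := mul_ne_zero Complex.I_ne_zero (by exact_mod_cast hτ)
  have hconj : Complex.Gamma (1 - Complex.I * τ) =
      (starRingEnd ℂ) (Complex.Gamma (Complex.I * τ + 1)) := by
    rw [← Complex.Gamma_conj]
    congr 1
    simp only [map_add, map_mul, Complex.conj_I, Complex.conj_ofReal, map_one]
    ring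
  have hsin : Complex.sin (π * (Complex.I * τ)) = (Real.sinh (π * τ) : ℂ) * Complex.I := by
    rw [Complex.ofReal_sinh, ← Complex.sin_mul_I]
    congr 1
    push_cast
    ring
  have hsinh : Real.sinh (π * τ) ≠ 0 := by
    rw [Ne, Real.sinh_eq_zero]
    exact mul_ne_zero Real.pi_ne_zero hτ
  have hsq : ‖Complex.Gamma (Complex.I * τ + 1)‖ ^ 2 = π * τ / Real.sinh (π * τ) := by
    have hrefl := Complex.Gamma_mul_Gamma_one_sub (Complex.I * τ)
    rw [hsin] at hrefl
    have hmul := Complex.mul_conj (Complex.Gamma (Complex.I * τ + 1))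
    rw [← hconj, Complex.Gamma_add_one _ hI, mul_assoc, hrefl, ← Complex.Gamma_add_one _ hI,
      Complex.normSq_eq_norm_sq] at hmul
    have hsinh' : (Real.sinh (π * τ) : ℂ) ≠ 0 := by exact_mod_cast hsinh
    apply Complex.ofReal_injective
    rw [← hmul, Complex.ofReal_div, Complex.ofReal_mul]
    field_simp
  rw [← Real.sqrt_sq (inv_nonneg.2 (norm_nonneg _)), inv_pow, hsq, inv_div]

theorem factorial_mul_norm_Gamma_le (τ : ℝ) (k : ℕ) :
    (k.factorial : ℝ) * ‖Complex.Gamma (Complex.I * τ + 1)‖ ≤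
      ‖Complex.Gamma ((k : ℂ) + Complex.I * τ + 1)‖ := by
  induction k with
  | zero => simp
  | succ k ih =>
    have hre : ((k : ℂ) + Complex.I * τ + 1).re = (k : ℝ) + 1 := by simp
    have hne : (k : ℂ) + Complex.I * τ + 1 ≠ 0 := by
      intro h
      rw [h, Complex.zero_re] at hre
      linarith [(k.cast_nonneg : (0 : ℝ) ≤ k)]
    have hnorm : (k : ℝ) + 1 ≤ ‖(k : ℂ) + Complex.I * τ + 1‖ := hre ▸ Complex.re_le_norm _
    have harg : ((k + 1 : ℕ) : ℂ) + Complex.I * τ + 1 = ((k : ℂ) + Complex.I * τ + 1) + 1 := by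
      push_cast
      ring
    rw [harg, Complex.Gamma_add_one _ hne, norm_mul, Nat.factorial_succ]
    push_cast
    rw [mul_assoc]
    gcongr

theorem half_pow_div_factorial_sq_le (x : ℝ) (k : ℕ) :
    (x / 2) ^ (2 * k) / (k.factorial : ℝ) ^ 2 ≤ x ^ (2 * k) / ((2 * k).factorial : ℝ) := by
  have hfact : (2 * k).factorial ≤ 2 ^ (2 * k) * k.factorial ^ 2 := by
    have h := Nat.choose_mul_factorial_mul_factorial (show k ≤ 2 * k by omega)
    rw [show 2 * k - k = k by omega, mul_assoc, ← sq] at h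
    rw [← h]
    gcongr
    exact Nat.choose_le_two_pow _ _
  have hfact' : ((2 * k).factorial : ℝ) ≤ 2 ^ (2 * k) * (k.factorial : ℝ) ^ 2 := by
    exact_mod_cast hfact
  rw [div_pow, div_div]
  have hx : 0 ≤ x ^ (2 * k) := (even_two_mul k).pow_nonneg x
  gcongr

/-- For all `x > 0` and real `τ ≠ 0`,
`|J_{iτ}(x)| ≤ e^x · √(sinh(πτ)/(πτ))`. -/
theorem besselJ_imaginary_order_abs_le (x τ : ℝ) (hx : 0 < x) (hτ : τ ≠ 0) :
    ‖besselJ (Complex.I * τ) (x : ℂ)‖ ≤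
      Real.exp x * Real.sqrt (Real.sinh (π * τ) / (π * τ)) := by
  rw [← inv_norm_Gamma_one_add_I_mul τ hτ]
  set G := ‖Complex.Gamma (Complex.I * τ + 1)‖
  have hGpos : 0 < G := norm_pos_iff.2 (Complex.Gamma_ne_zero_of_re_pos (by simp))
  have hsum := (Real.hasSum_cosh x).mul_right G⁻¹
  have hbound : ‖besselJ (Complex.I * τ) (x : ℂ)‖ ≤ Real.cosh x * G⁻¹ := by
    refine tsum_of_norm_bounded hsum fun k => ?_
    have hpow : ‖((x : ℂ) / 2) ^ (2 * (k : ℂ) + Complex.I * τ)‖ = (x / 2) ^ (2 * k) := by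
      have hcast : (x : ℂ) / 2 = ((x / 2 : ℝ) : ℂ) := by push_cast; rfl
      have hre : (2 * (k : ℂ) + Complex.I * τ).re = ((2 * k : ℕ) : ℝ) := by simp
      rw [hcast, Complex.norm_cpow_eq_rpow_re_of_pos (half_pos hx), hre, Real.rpow_natCast]
    rw [norm_div, norm_mul, norm_mul, hpow, norm_pow, norm_neg, norm_one, one_pow, one_mul,
      Complex.norm_natCast]
    calc (x / 2) ^ (2 * k) /
          ((k.factorial : ℝ) * ‖Complex.Gamma ((k : ℂ) + Complex.I * τ + 1)‖)
        ≤ (x / 2) ^ (2 * k) / ((k.factorial : ℝ) * ((k.factorial : ℝ) * G)) := by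
          gcongr
          exact factorial_mul_norm_Gamma_le τ k
      _ = (x / 2) ^ (2 * k) / (k.factorial : ℝ) ^ 2 * G⁻¹ := by
          field_simp
      _ ≤ x ^ (2 * k) / ((2 * k).factorial : ℝ) * G⁻¹ := by
          gcongr ?_ * _
          exact half_pow_div_factorial_sq_le x k
  refine hbound.trans ?_
  gcongr
  rw [← Real.cosh_add_sinh x]
  linarith [Real.sinh_pos_iff.2 hx]
end

section
/- For every x > 0, every real τ, and every γ ∈ (0, 1/4), the kernel Φ_τ(x) = (√π / cosh(πτ)) · Re[J_{iτ}(√x)²] admits the Mellin–Barnes integral representation Φ_τ(x) = (1/(2πi)) ∫_{γ−i∞}^{γ+i∞} [Γ(s+iτ)Γ(s−iτ)Γ(1/2−s) / (Γ(s)Γ(1−s)²)] x^{−s} ds, the integral converging absolutely. -/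
open Complex MeasureTheory Real Set

/-- The kernel `Φ_τ(x) = (√π / cosh(πτ)) · Re[J_{iτ}(√x)²]`. -/
noncomputable def Phi (τ x : ℝ) : ℝ :=
  (Real.sqrt π / Real.cosh (π * τ)) * ((besselJ (Complex.I * τ) (Real.sqrt x : ℂ)) ^ 2).re

/-- The integrand of the Mellin–Barnes representation (1.9) on the line `Re s = γ`. -/
noncomputable def mellinBarnesRatio (γ τ : ℝ) (t : ℝ) : ℂ :=
  Complex.Gamma ((γ : ℂ) + t * Complex.I + Complex.I * τ) *
      Complex.Gamma ((γ : ℂ) + t * Complex.I - Complex.I * τ) *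
      Complex.Gamma (1 / 2 - ((γ : ℂ) + t * Complex.I)) /
    (Complex.Gamma ((γ : ℂ) + t * Complex.I) *
      Complex.Gamma (1 - ((γ : ℂ) + t * Complex.I)) ^ 2)

/-- The factors in the Euler product for `‖Γ(u + it)‖ / Γ(u)`. -/
noncomputable def gammaDecayFactor (t u : ℝ) : ℝ := (1 + (t / u) ^ 2) ^ (-(1 / 2) : ℝ)

theorem gammaDecayFactor_pos (t u : ℝ) : 0 < gammaDecayFactor t u := by
  unfold gammaDecayFactor; positivity

theorem gammaDecayFactor_eq {t u : ℝ} (hu : 0 < u) :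
    gammaDecayFactor t u = u / ‖(u + t * Complex.I : ℂ)‖ := by
  rw [gammaDecayFactor, Complex.norm_add_mul_I, Real.rpow_neg (by positivity), ← Real.sqrt_eq_rpow]
  have : 1 + (t / u) ^ 2 = (u ^ 2 + t ^ 2) / u ^ 2 := by field_simp
  rw [this, Real.sqrt_div (by positivity), Real.sqrt_sq hu.le, inv_div]

theorem gammaDecayFactor_mono (t : ℝ) {u v : ℝ} (hu : 0 < u) (huv : u ≤ v) :
    gammaDecayFactor t u ≤ gammaDecayFactor t v := by
  unfold gammaDecayFactor
  apply Real.rpow_le_rpow_of_nonpos (by positivity) _ (by norm_num)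
  rw [div_pow, div_pow]
  gcongr

theorem gammaDecayFactor_concave (t : ℝ) {u v a b : ℝ} (hu : 0 < u) (hv : 0 < v)
    (ha : 0 ≤ a) (hb : 0 ≤ b) (hab : a + b = 1) :
    gammaDecayFactor t u ^ a * gammaDecayFactor t v ^ b ≤ gammaDecayFactor t (a * u + b * v) := by
  have hw : 0 < a * u + b * v := by
    rcases ha.eq_or_lt with rfl | ha'
    · have : b = 1 := by linarith
      subst this; simpa using hv
    · have := mul_pos ha' hu
      positivity
  set p : ℝ := (t / u) ^ 2
  set q : ℝ := (t / v) ^ 2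
  have hp : 0 ≤ p := sq_nonneg _
  have hq : 0 ≤ q := sq_nonneg _
  have hgm : (t / (a * u + b * v)) ^ 2 ≤ p ^ a * q ^ b := by
    have h1 := Real.geom_mean_le_arith_mean2_weighted ha hb hu.le hv.le hab
    have h2 : p ^ a * q ^ b = (t / (u ^ a * v ^ b)) ^ 2 := by
      have ht : (t ^ 2) ^ a * (t ^ 2) ^ b = t ^ 2 := by
        rw [← Real.rpow_add_of_nonneg (sq_nonneg t) ha hb, hab, Real.rpow_one]
      simp only [p, q, div_pow, mul_pow]
      rw [Real.div_rpow (by positivity) (by positivity),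
        Real.div_rpow (by positivity) (by positivity), div_mul_div_comm, ht,
        Real.rpow_pow_comm hu.le, Real.rpow_pow_comm hv.le]
    rw [h2, div_pow, div_pow]
    have : 0 < u ^ a * v ^ b := by positivity
    gcongr
  have hmink : 1 + p ^ a * q ^ b ≤ (1 + p) ^ a * (1 + q) ^ b := by
    have h1 := Real.geom_mean_le_arith_mean2_weighted ha hb
      (show 0 ≤ 1 / (1 + p) by positivity) (show 0 ≤ 1 / (1 + q) by positivity) hab
    have h2 := Real.geom_mean_le_arith_mean2_weighted ha hb
      (show 0 ≤ p / (1 + p) by positivity) (show 0 ≤ q / (1 + q) by positivity) hab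
    rw [Real.div_rpow (by positivity) (by positivity),
      Real.div_rpow (by positivity) (by positivity), div_mul_div_comm] at h1 h2
    simp only [Real.one_rpow, one_mul] at h1
    have hsum : a * (1 / (1 + p)) + b * (1 / (1 + q)) + (a * (p / (1 + p)) + b * (q / (1 + q)))
        = 1 := by
      rw [← hab]; field_simp; ring
    have h3 : (1 + p ^ a * q ^ b) / ((1 + p) ^ a * (1 + q) ^ b) ≤ 1 := by
      rw [add_div]; linarith
    rwa [div_le_one (by positivity)] at h3
  unfold gammaDecayFactor
  rw [← Real.rpow_mul (by positivity), ← Real.rpow_mul (by positivity), mul_comm _ a, mul_comm _ b,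
    Real.rpow_mul (by positivity), Real.rpow_mul (by positivity),
    ← Real.mul_rpow (by positivity) (by positivity)]
  exact Real.rpow_le_rpow_of_nonpos (by positivity) (by linarith) (by norm_num)

theorem prod_gammaDecayFactor_tendsto (t : ℝ) {u : ℝ} (hu : 0 < u) :
    Filter.Tendsto (fun n : ℕ => ∏ j ∈ Finset.range (n + 1), gammaDecayFactor t (u + j))
      Filter.atTop (nhds (‖Complex.Gamma (u + t * Complex.I)‖ / Real.Gamma u)) := by
  have h1 := (Complex.GammaSeq_tendsto_Gamma (u + t * Complex.I)).norm
  have h2 := Real.GammaSeq_tendsto_Gamma u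
  refine (h1.div h2 (Real.Gamma_pos_of_pos hu).ne').congr' ?_
  filter_upwards [Filter.eventually_gt_atTop 0] with n hn
  have hn' : (0 : ℝ) < n := by exact_mod_cast hn
  simp only [Pi.div_apply, Complex.GammaSeq, Real.GammaSeq]
  rw [norm_div, norm_mul, norm_prod, Complex.norm_natCast_cpow_of_pos hn]
  have hP : (∏ j ∈ Finset.range (n + 1), (u + j)) ≠ 0 :=
    Finset.prod_ne_zero_iff.2 fun j _ => by positivity
  have hQ : (∏ j ∈ Finset.range (n + 1), ‖(u + t * Complex.I + j : ℂ)‖) ≠ 0 := by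
    refine Finset.prod_ne_zero_iff.2 fun j _ => norm_ne_zero_iff.2 fun h => ?_
    have := congrArg Complex.re h
    simp at this
    have : (0 : ℝ) < u + j := by positivity
    linarith
  have hR : ∏ j ∈ Finset.range (n + 1), gammaDecayFactor t (u + j) =
      (∏ j ∈ Finset.range (n + 1), (u + j)) /
        ∏ j ∈ Finset.range (n + 1), ‖(u + t * Complex.I + j : ℂ)‖ := by
    rw [← Finset.prod_div_distrib]
    refine Finset.prod_congr rfl fun j _ => ?_
    rw [gammaDecayFactor_eq (by positivity)]
    congr 2
    push_cast; ring
  rw [hR]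
  have hre : (u + t * Complex.I : ℂ).re = u := by simp
  rw [hre, Complex.norm_natCast]
  have : (n : ℝ) ^ u ≠ 0 := by positivity
  have : (n.factorial : ℝ) ≠ 0 := by positivity
  field_simp

/-- `‖Γ(u + it)‖ / Γ(u)` is nondecreasing in `u > 0`. -/
theorem norm_Gamma_div_Gamma_mono (t : ℝ) {u v : ℝ} (hu : 0 < u) (huv : u ≤ v) :
    ‖Complex.Gamma (u + t * Complex.I)‖ / Real.Gamma u ≤
      ‖Complex.Gamma (v + t * Complex.I)‖ / Real.Gamma v :=
  le_of_tendsto_of_tendsto' (prod_gammaDecayFactor_tendsto t hu)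
    (prod_gammaDecayFactor_tendsto t (hu.trans_le huv)) fun n =>
    Finset.prod_le_prod (fun j _ => (gammaDecayFactor_pos _ _).le) fun j _ =>
      gammaDecayFactor_mono t (by positivity) (by linarith)

/-- `‖Γ(u + it)‖ / Γ(u)` is log-concave in `u > 0`. -/
theorem norm_Gamma_div_Gamma_concave (t : ℝ) {u v a b : ℝ} (hu : 0 < u) (hv : 0 < v)
    (ha : 0 ≤ a) (hb : 0 ≤ b) (hab : a + b = 1) (hw : 0 < a * u + b * v) :
    (‖Complex.Gamma (u + t * Complex.I)‖ / Real.Gamma u) ^ a *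
      (‖Complex.Gamma (v + t * Complex.I)‖ / Real.Gamma v) ^ b ≤
      ‖Complex.Gamma ((a * u + b * v : ℝ) + t * Complex.I)‖ / Real.Gamma (a * u + b * v) := by
  refine le_of_tendsto_of_tendsto'
    (((prod_gammaDecayFactor_tendsto t hu).rpow_const (Or.inr ha)).mul
      ((prod_gammaDecayFactor_tendsto t hv).rpow_const (Or.inr hb)))
    (prod_gammaDecayFactor_tendsto t hw) fun n => ?_
  rw [← Real.finsetProd_rpow _ _ fun j _ => (gammaDecayFactor_pos _ _).le,
    ← Real.finsetProd_rpow _ _ fun j _ => (gammaDecayFactor_pos _ _).le, ← Finset.prod_mul_distrib]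
  refine Finset.prod_le_prod (fun j _ => ?_) fun j _ => ?_
  · have := gammaDecayFactor_pos t (u + j)
    have := gammaDecayFactor_pos t (v + j)
    positivity
  · have h := gammaDecayFactor_concave t (u := u + j) (v := v + j) (by positivity) (by positivity)
      ha hb hab
    rwa [show a * (u + j) + b * (v + j) = a * u + b * v + j by
      linear_combination (j : ℝ) * hab] at h

theorem norm_sin_sq (z : ℂ) :
    ‖Complex.sin z‖ ^ 2 = Real.sin z.re ^ 2 + Real.sinh z.im ^ 2 := by
  rw [Complex.sq_norm, Complex.sin_eq, Complex.normSq_apply]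
  simp only [← Complex.ofReal_sin, ← Complex.ofReal_cos, ← Complex.ofReal_sinh,
    ← Complex.ofReal_cosh, Complex.add_re, Complex.add_im, Complex.mul_re, Complex.mul_im,
    Complex.ofReal_re, Complex.ofReal_im, Complex.I_re, Complex.I_im]
  have h1 := Real.sin_sq_add_cos_sq z.re
  have h2 := Real.cosh_sq z.im
  ring_nf
  rw [h2, Real.cos_sq']
  ring

theorem norm_sin_le_exp (z : ℂ) : ‖Complex.sin z‖ ≤ Real.exp |z.im| := by
  have h : ‖Complex.sin z‖ ≤ Real.cosh z.im := by
    refine le_of_sq_le_sq ?_ (Real.cosh_pos _).le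
    rw [norm_sin_sq, Real.cosh_sq]
    nlinarith [Real.sin_sq_le_one z.re]
  refine h.trans ?_
  rw [← Real.cosh_abs, Real.cosh_eq]
  have : Real.exp (-|z.im|) ≤ Real.exp |z.im| :=
    Real.exp_le_exp.2 (by have := abs_nonneg z.im; linarith)
  linarith

theorem le_norm_sin (z : ℂ) : Real.sin z.re * (Real.exp |z.im| / 2) ≤ ‖Complex.sin z‖ := by
  have h1 : |Real.sin z.re| * Real.cosh z.im ≤ ‖Complex.sin z‖ := by
    refine le_of_sq_le_sq ?_ (norm_nonneg _)
    rw [norm_sin_sq, mul_pow, sq_abs, Real.cosh_sq]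
    nlinarith [Real.sin_sq_le_one z.re, sq_nonneg (Real.sinh z.im)]
  have h2 : Real.exp |z.im| / 2 ≤ Real.cosh z.im := by
    rw [← Real.cosh_abs, Real.cosh_eq]
    have := Real.exp_pos (-|z.im|)
    linarith
  refine le_trans ?_ h1
  exact mul_le_mul (le_abs_self _) h2 (by positivity) (abs_nonneg _)

theorem abs_sinh_le_norm_sin (z : ℂ) : |Real.sinh z.im| ≤ ‖Complex.sin z‖ := by
  refine le_of_sq_le_sq ?_ (norm_nonneg _)
  rw [norm_sin_sq, sq_abs]
  nlinarith [sq_nonneg (Real.sin z.re)]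

theorem norm_Gamma_conj (z : ℂ) : ‖Complex.Gamma (starRingEnd ℂ z)‖ = ‖Complex.Gamma z‖ := by
  rw [Complex.Gamma_conj, Complex.norm_conj]

theorem exp_le_norm_Gamma_half_sq (t : ℝ) :
    π * Real.exp (-(π * |t|)) ≤ ‖Complex.Gamma ((1 / 2 : ℝ) + t * Complex.I)‖ ^ 2 := by
  have h := congrArg norm (Complex.Gamma_mul_Gamma_one_sub ((1 / 2 : ℝ) + t * Complex.I))
  have h1 : (1 - ((1 / 2 : ℝ) + t * Complex.I) : ℂ) =
      starRingEnd ℂ ((1 / 2 : ℝ) + t * Complex.I) := by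
    simp only [map_add, map_mul, Complex.conj_ofReal, Complex.conj_I]
    push_cast; ring
  rw [h1, norm_mul, norm_Gamma_conj, ← sq, norm_div, Complex.norm_real, Real.norm_of_nonneg
    Real.pi_pos.le] at h
  rw [h, Real.exp_neg, ← div_eq_mul_inv]
  have h2 := norm_sin_le_exp (π * ((1 / 2 : ℝ) + t * Complex.I))
  have h3 : (π * ((1 / 2 : ℝ) + t * Complex.I) : ℂ).im = π * t := by simp
  rw [h3, abs_mul, abs_of_pos Real.pi_pos] at h2
  refine div_le_div_of_nonneg_left Real.pi_pos.le ?_ h2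
  have h4 := le_norm_sin (π * ((1 / 2 : ℝ) + t * Complex.I))
  refine lt_of_lt_of_le ?_ h4
  have h5 : (π * ((1 / 2 : ℝ) + t * Complex.I) : ℂ).re = π / 2 := by simp; ring
  rw [h5, Real.sin_pi_div_two]
  positivity

theorem exp_le_norm_Gamma_one_sq (t : ℝ) :
    (1 + |t|) / 2 * Real.exp (-(π * |t|)) ≤
      ‖Complex.Gamma ((1 : ℝ) + t * Complex.I)‖ ^ 2 := by
  rcases eq_or_ne t 0 with rfl | ht
  · simp; norm_num
  have hz : (t * Complex.I : ℂ) ≠ 0 := by simp [ht]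
  have h := congrArg norm (Complex.Gamma_mul_Gamma_one_sub (t * Complex.I))
  have h1 : (1 - t * Complex.I : ℂ) = starRingEnd ℂ ((1 : ℝ) + t * Complex.I) := by
    simp only [map_add, map_mul, Complex.conj_ofReal, Complex.conj_I]
    push_cast; ring
  have h0 : Complex.Gamma ((1 : ℝ) + t * Complex.I) =
      t * Complex.I * Complex.Gamma (t * Complex.I) := by
    rw [← Complex.Gamma_add_one _ hz, add_comm]; simp
  have ht' : 0 < |t| := abs_pos.2 ht
  have h2 : ‖Complex.Gamma ((1 : ℝ) + t * Complex.I)‖ ^ 2 =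
      π * |t| / Real.sinh (π * |t|) := by
    rw [h1, norm_mul, norm_Gamma_conj, norm_div, Complex.norm_real,
      Real.norm_of_nonneg Real.pi_pos.le] at h
    have h3 : ‖Complex.sin (π * (t * Complex.I))‖ = Real.sinh (π * |t|) := by
      rw [← mul_assoc, ← Complex.ofReal_mul, Complex.sin_mul_I, norm_mul, Complex.norm_I, mul_one,
        ← Complex.ofReal_sinh, Complex.norm_real, Real.norm_eq_abs, Real.abs_sinh, abs_mul,
        abs_of_pos Real.pi_pos]
    rw [h3] at h
    calc _ = |t| * (‖Complex.Gamma (t * Complex.I)‖ *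
          ‖Complex.Gamma ((1 : ℝ) + t * Complex.I)‖) := by
          rw [sq]; nth_rewrite 1 [h0]; simp [mul_assoc]
      _ = _ := by rw [h]; ring
  rw [h2]
  set y := π * |t| with hy
  have hy0 : 0 < y := by positivity
  have hs : 0 < Real.sinh y := Real.sinh_pos_iff.2 hy0
  rw [le_div_iff₀ hs]
  have hty : |t| ≤ y := by
    rw [hy]; nlinarith [Real.pi_gt_three]
  have hE : Real.exp (-y) * Real.sinh y = (1 - Real.exp (-(2 * y))) / 2 := by
    rw [Real.sinh_eq]
    have e1 : Real.exp (-y) * Real.exp y = 1 := by rw [← Real.exp_add]; simp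
    have e2 : Real.exp (-y) * Real.exp (-y) = Real.exp (-(2 * y)) := by
      rw [← Real.exp_add]; ring_nf
    linear_combination e1 / 2 - e2 / 2
  have hb1 := Real.add_one_le_exp (-(2 * y))
  have hb2 := Real.exp_pos (-(2 * y))
  rw [mul_assoc, hE]
  nlinarith

/-- A lower bound of the correct order in `t` for `‖Γ(v + it)‖`, where `1 / 2 ≤ v ≤ 1`. -/
theorem le_norm_Gamma {v : ℝ} (h1 : 1 / 2 ≤ v) (h2 : v ≤ 1) :
    ∃ c > 0, ∀ t : ℝ, c * ((1 + |t|) ^ (v - 1 / 2) * Real.exp (-(π * |t| / 2))) ≤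
      ‖Complex.Gamma (v + t * Complex.I)‖ := by
  have hG : 0 < Real.Gamma v := Real.Gamma_pos_of_pos (by linarith)
  refine ⟨Real.Gamma v * (1 / 2) ^ (v - 1 / 2), by positivity, fun t => ?_⟩
  have hc := norm_Gamma_div_Gamma_concave t (u := 1 / 2) (v := 1) (a := 2 - 2 * v)
    (b := 2 * v - 1) (by norm_num) (by norm_num) (by linarith) (by linarith) (by ring)
    (by ring_nf; linarith)
  have hv : (2 - 2 * v) * (1 / 2) + (2 * v - 1) * 1 = v := by ring
  rw [hv, le_div_iff₀ hG, Real.Gamma_one, div_one, Real.Gamma_one_half_eq] at hc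
  have hexp : Real.exp (-(π * |t| / 2)) ^ 2 = Real.exp (-(π * |t|)) := by
    rw [← Real.exp_nat_mul]; congr 1; push_cast; ring
  have ha : Real.exp (-(π * |t| / 2)) ≤
      ‖Complex.Gamma ((1 / 2 : ℝ) + t * Complex.I)‖ / √π := by
    refine le_of_sq_le_sq ?_ (by positivity)
    rw [div_pow, Real.sq_sqrt Real.pi_pos.le, le_div_iff₀ Real.pi_pos, hexp, mul_comm]
    exact exp_le_norm_Gamma_half_sq t
  have hb : ((1 + |t|) / 2) ^ (1 / 2 : ℝ) * Real.exp (-(π * |t| / 2)) ≤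
      ‖Complex.Gamma ((1 : ℝ) + t * Complex.I)‖ := by
    refine le_of_sq_le_sq ?_ (by positivity)
    rw [mul_pow, ← Real.sqrt_eq_rpow, Real.sq_sqrt (by positivity), hexp]
    exact exp_le_norm_Gamma_one_sq t
  have hm := mul_le_mul (Real.rpow_le_rpow (by positivity) ha (show 0 ≤ 2 - 2 * v by linarith))
    (Real.rpow_le_rpow (by positivity) hb (show 0 ≤ 2 * v - 1 by linarith))
    (by positivity) (by positivity)
  refine le_trans (le_of_eq ?_) ((mul_le_mul_of_nonneg_right hm hG.le).trans hc)
  rw [Real.mul_rpow (by positivity) (by positivity), ← Real.rpow_mul (by positivity),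
    Real.div_rpow (by positivity) (by positivity), Real.div_rpow (by positivity) (by positivity),
    Real.one_rpow]
  have e : Real.exp (-(π * |t| / 2)) =
    Real.exp (-(π * |t| / 2)) ^ (2 - 2 * v) * Real.exp (-(π * |t| / 2)) ^ (2 * v - 1) := by
    rw [← Real.rpow_add (Real.exp_pos _)]; ring_nf; rw [Real.rpow_one]
  conv_lhs => rw [e]
  rw [show 1 / 2 * (2 * v - 1) = v - 1 / 2 by ring]
  ring

/-- The matching upper bound for `‖Γ(w + it)‖`, where `0 < w ≤ 1 / 2`. -/
theorem norm_Gamma_le {w : ℝ} (h1 : 0 < w) (h2 : w ≤ 1 / 2) :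
    ∃ c > 0, ∀ t : ℝ, ‖Complex.Gamma (w + t * Complex.I)‖ ≤
      c * ((1 + |t|) ^ (w - 1 / 2) * Real.exp (-(π * |t| / 2))) := by
  obtain ⟨c, hc, h⟩ := le_norm_Gamma (v := 1 - w) (by linarith) (by linarith)
  have hs : 0 < Real.sin (π * w) :=
    Real.sin_pos_of_pos_of_lt_pi (by positivity) (by nlinarith [Real.pi_pos])
  refine ⟨2 * π / (c * Real.sin (π * w)), by positivity, fun t => ?_⟩
  have hr := congrArg norm (Complex.Gamma_mul_Gamma_one_sub (w + t * Complex.I))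
  rw [norm_mul, norm_div, Complex.norm_real, Real.norm_of_nonneg Real.pi_pos.le] at hr
  have hl := h (-t)
  have hz : (((1 - w : ℝ) : ℂ) + ((-t : ℝ) : ℂ) * Complex.I) = 1 - (w + t * Complex.I) := by
    push_cast; ring
  rw [hz, abs_neg] at hl
  have hsin := le_norm_sin (π * (w + t * Complex.I))
  have hre : (π * (w + t * Complex.I) : ℂ).re = π * w := by simp
  have him : (π * (w + t * Complex.I) : ℂ).im = π * t := by simp
  rw [hre, him, abs_mul, abs_of_pos Real.pi_pos] at hsin
  have hpos : 0 < c * ((1 + |t|) ^ (1 - w - 1 / 2) * Real.exp (-(π * |t| / 2))) := by positivity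
  have hsp : 0 < Real.sin (π * w) * (Real.exp (π * |t|) / 2) := by positivity
  have key : ‖Complex.Gamma (w + t * Complex.I)‖ *
      (c * ((1 + |t|) ^ (1 - w - 1 / 2) * Real.exp (-(π * |t| / 2)))) ≤
      π / (Real.sin (π * w) * (Real.exp (π * |t|) / 2)) :=
    (mul_le_mul_of_nonneg_left hl (norm_nonneg _)).trans
      (hr.le.trans (div_le_div_of_nonneg_left Real.pi_pos.le hsp hsin))
  rw [← le_div_iff₀ hpos] at key
  refine key.trans (le_of_eq ?_)
  have e1 : Real.exp (π * |t|) = (Real.exp (-(π * |t| / 2)))⁻¹ ^ 2 := by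
    rw [← Real.exp_neg, ← Real.exp_nat_mul]; congr 1; push_cast; ring
  have e2 : (1 + |t|) ^ (1 - w - 1 / 2) = ((1 + |t|) ^ (w - 1 / 2))⁻¹ := by
    rw [← Real.rpow_neg (by positivity)]; congr 1; ring
  rw [e1, e2]
  have : (0 : ℝ) < (1 + |t|) ^ (w - 1 / 2) := by positivity
  have := Real.exp_pos (-(π * |t| / 2))
  field_simp

/-- Two vertical line integrals of a function holomorphic on the strip between them agree, when
the function is integrable on both lines and decays uniformly along the strip. -/
theorem integral_vertical_eq {f : ℂ → ℂ} {a b : ℝ} (hab : a ≤ b) (B : ℝ → ℝ)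
    (hB : Filter.Tendsto B Filter.atTop (nhds 0))
    (hd : DifferentiableOn ℂ f {z | a ≤ z.re ∧ z.re ≤ b})
    (ha : Integrable fun t : ℝ => f (a + t * Complex.I))
    (hb : Integrable fun t : ℝ => f (b + t * Complex.I))
    (hbd : ∀ z : ℂ, a ≤ z.re → z.re ≤ b → 1 ≤ |z.im| → ‖f z‖ ≤ B |z.im|) :
    ∫ t : ℝ, f (a + t * Complex.I) = ∫ t : ℝ, f (b + t * Complex.I) := by
  have hneg := Filter.tendsto_neg_atTop_atBot (G := ℝ)
  have la := intervalIntegral_tendsto_integral ha hneg Filter.tendsto_id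
  have lb := intervalIntegral_tendsto_integral hb hneg Filter.tendsto_id
  have hhor : ∀ T : ℝ, 1 ≤ |T| →
      ‖∫ x : ℝ in a..b, f (x + (T : ℝ) * Complex.I)‖ ≤ B |T| * |b - a| := by
    intro T hT
    refine intervalIntegral.norm_integral_le_of_norm_le_const fun x hx => ?_
    rw [Set.uIoc_of_le hab] at hx
    have := hbd (x + (T : ℝ) * Complex.I) (by simpa using hx.1.le) (by simpa using hx.2)
      (by simpa using hT)
    simpa using this
  have hBT : Filter.Tendsto (fun T : ℝ => B |T| * |b - a|) Filter.atTop (nhds 0) := by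
    have := (hB.comp Filter.tendsto_abs_atTop_atTop).mul_const |b - a|
    simpa using this
  have h1 : Filter.Tendsto (fun T : ℝ => ∫ x : ℝ in a..b, f (x + (T : ℝ) * Complex.I))
      Filter.atTop (nhds 0) := by
    refine squeeze_zero_norm' ?_ hBT
    filter_upwards [Filter.eventually_ge_atTop 1] with T hT
    exact hhor T (hT.trans (le_abs_self T))
  have h2 : Filter.Tendsto (fun T : ℝ => ∫ x : ℝ in a..b, f (x + ((-T : ℝ) : ℂ) * Complex.I))
      Filter.atTop (nhds 0) := by
    refine squeeze_zero_norm' ?_ hBT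
    filter_upwards [Filter.eventually_ge_atTop 1] with T hT
    have := hhor (-T) (by rw [abs_neg]; exact hT.trans (le_abs_self T))
    rwa [abs_neg] at this
  have hrect : ∀ T : ℝ, (∫ x : ℝ in a..b, f (x + ((-T : ℝ) : ℂ) * Complex.I)) -
      (∫ x : ℝ in a..b, f (x + (T : ℝ) * Complex.I)) +
      Complex.I • (∫ y : ℝ in (-T)..T, f (b + y * Complex.I)) -
      Complex.I • (∫ y : ℝ in (-T)..T, f (a + y * Complex.I)) = 0 := by
    intro T
    have := Complex.integral_boundary_rect_eq_zero_of_differentiableOn f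
      (⟨a, -T⟩ : ℂ) (⟨b, T⟩ : ℂ) (hd.mono fun z hz => by
        have := hz.1
        rw [Set.mem_preimage, Set.uIcc_of_le hab] at this
        exact this)
    simpa using this
  have hlim := ((h2.sub h1).add (lb.const_smul Complex.I)).sub (la.const_smul Complex.I)
  have hz := tendsto_nhds_unique (hlim.congr fun T => hrect T) tendsto_const_nhds
  rw [sub_zero, zero_add, ← smul_sub, smul_eq_zero_iff_right Complex.I_ne_zero] at hz
  exact (sub_eq_zero.1 hz).symm

theorem sin_pi_mul_vertical_ne_zero {a : ℝ} (h0 : 0 < a) (h1 : a < 1) (t : ℝ) :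
    Complex.sin (π * (a + t * Complex.I)) ≠ 0 := by
  have h := le_norm_sin (π * (a + t * Complex.I))
  have hre : (π * (a + t * Complex.I) : ℂ).re = π * a := by simp
  have hs : 0 < Real.sin (π * a) :=
    Real.sin_pos_of_pos_of_lt_pi (by positivity) (by nlinarith [Real.pi_pos])
  rw [hre] at h
  exact norm_pos_iff.1 (lt_of_lt_of_le (by positivity) h)

theorem norm_pi_div_sin_le {a : ℝ} (h0 : 0 < a) (h1 : a < 1) (t : ℝ) :
    ‖(π : ℂ) / Complex.sin (π * (a + t * Complex.I))‖ ≤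
      2 * π / Real.sin (π * a) * Real.exp (-(π * |t|)) := by
  have h := le_norm_sin (π * (a + t * Complex.I))
  have hre : (π * (a + t * Complex.I) : ℂ).re = π * a := by simp
  have him : (π * (a + t * Complex.I) : ℂ).im = π * t := by simp
  have hs : 0 < Real.sin (π * a) :=
    Real.sin_pos_of_pos_of_lt_pi (by positivity) (by nlinarith [Real.pi_pos])
  rw [hre, him, abs_mul, abs_of_pos Real.pi_pos] at h
  rw [norm_div, Complex.norm_real, Real.norm_of_nonneg Real.pi_pos.le]
  refine (div_le_div_of_nonneg_left Real.pi_pos.le (by positivity) h).trans (le_of_eq ?_)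
  rw [Real.exp_neg]
  have := Real.exp_pos (π * |t|)
  field_simp

theorem continuous_pi_div_sin {a : ℝ} (h0 : 0 < a) (h1 : a < 1) :
    Continuous fun t : ℝ => (π : ℂ) / Complex.sin (π * (a + t * Complex.I)) :=
  continuous_const.div (by fun_prop) (sin_pi_mul_vertical_ne_zero h0 h1)

theorem integrable_of_norm_le_one_add_abs_rpow {f : ℝ → ℂ} (hf : Continuous f) {C r : ℝ}
    (hr : 1 < r) (h : ∀ t, ‖f t‖ ≤ C * (1 + |t|) ^ (-r)) : Integrable f := by
  have hi := (integrable_one_add_norm (E := ℝ) (μ := volume) (r := r) (by simpa using hr)).const_mul C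
  exact hi.mono' hf.aestronglyMeasurable (Filter.Eventually.of_forall h)

theorem exp_neg_pi_mul_abs_le (t : ℝ) :
    Real.exp (-(π * |t|)) ≤ (1 + |t|) ^ (-2 : ℝ) := by
  have h1 : (1 + |t|) ^ (2 : ℝ) ≤ Real.exp (π * |t|) := by
    calc (1 + |t|) ^ (2 : ℝ) ≤ (Real.exp |t|) ^ (2 : ℝ) := by
          gcongr; linarith [Real.add_one_le_exp |t|]
      _ = Real.exp (|t| * 2) := (Real.exp_mul _ _).symm
      _ ≤ _ := Real.exp_le_exp.2 (by nlinarith [abs_nonneg t, Real.pi_gt_three])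
  rw [Real.exp_neg, Real.rpow_neg (by positivity)]
  exact inv_anti₀ (by positivity) h1

theorem integrable_pi_div_sin {a : ℝ} (h0 : 0 < a) (h1 : a < 1) :
    Integrable fun t : ℝ => (π : ℂ) / Complex.sin (π * (a + t * Complex.I)) := by
  have hs : 0 < Real.sin (π * a) :=
    Real.sin_pos_of_pos_of_lt_pi (by positivity) (by nlinarith [Real.pi_pos])
  refine integrable_of_norm_le_one_add_abs_rpow (continuous_pi_div_sin h0 h1)
    (C := 2 * π / Real.sin (π * a)) (r := 2) (by norm_num) fun t =>
    (norm_pi_div_sin_le h0 h1 t).trans ?_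
  gcongr
  exact exp_neg_pi_mul_abs_le t

theorem integral_pi_div_sin {a : ℝ} (h0 : 0 < a) (h1 : a < 1) :
    ∫ t : ℝ, (π : ℂ) / Complex.sin (π * (a + t * Complex.I)) = π := by
  set v : ℝ → ℂ := fun t => Complex.exp (π * (a + t * Complex.I) * Complex.I) with hv
  set q : ℝ → ℂ := fun t => -Complex.I * ((v t - 1) / (v t + 1)) with hq
  have hvim : ∀ t, 0 < (v t).im := by
    intro t
    have : (π * (a + t * Complex.I) * Complex.I : ℂ).im = π * a := by simp
    rw [hv, Complex.exp_im, this]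
    have hs : 0 < Real.sin (π * a) :=
      Real.sin_pos_of_pos_of_lt_pi (by positivity) (by nlinarith [Real.pi_pos])
    positivity
  have hv1 : ∀ t, v t + 1 ≠ 0 := fun t h => by
    have := congrArg Complex.im h
    simp at this
    exact (hvim t).ne' this
  have hv2 : ∀ t, v t - 1 ≠ 0 := fun t h => by
    have := congrArg Complex.im h
    simp at this
    exact (hvim t).ne' this
  have hv0 : ∀ t, v t ≠ 0 := fun t => Complex.exp_ne_zero _
  have hvd : ∀ t, HasDerivAt v (-π * v t) t := by
    intro t
    have h : HasDerivAt (fun t : ℝ => (π * (a + t * Complex.I) * Complex.I : ℂ))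
        (π * (1 * Complex.I) * Complex.I) t :=
      ((((Complex.ofRealCLM.hasDerivAt (x := t)).mul_const Complex.I).const_add
        (a : ℂ)).const_mul (π : ℂ)).mul_const Complex.I
    convert h.cexp using 1
    simp only [hv]
    linear_combination (-π * Complex.exp (π * (a + t * Complex.I) * Complex.I)) * Complex.I_mul_I
  have hqs : ∀ t, q t ∈ Complex.slitPlane := by
    intro t
    refine Or.inl ?_
    have h2 : 0 < Complex.normSq (v t + 1) := Complex.normSq_pos.2 (hv1 t)
    have h3 : (q t).re = 2 * (v t).im / Complex.normSq (v t + 1) := by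
      simp only [hq, Complex.mul_re, Complex.neg_re, Complex.I_re, Complex.neg_im, Complex.I_im,
        Complex.div_im, Complex.sub_im, Complex.sub_re, Complex.add_re, Complex.add_im,
        Complex.one_re, Complex.one_im]
      ring
    rw [h3]
    have := hvim t
    positivity
  have hd : ∀ t : ℝ, HasDerivAt (fun t => Complex.log (q t))
      (Complex.I * ((π : ℂ) / Complex.sin (π * (a + t * Complex.I)))) t := by
    intro t
    have h := ((((hvd t).sub_const 1).div ((hvd t).add_const 1) (hv1 t)).const_mul
      (-Complex.I)).clog_real (hqs t)
    refine HasDerivAt.congr_deriv h ?_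
    have hsin : Complex.sin (π * (a + t * Complex.I)) = ((v t)⁻¹ - v t) * Complex.I / 2 := by
      rw [Complex.sin, neg_mul, Complex.exp_neg]
    have hs0 := sin_pi_mul_vertical_ne_zero h0 h1 t
    rw [hsin] at hs0 ⊢
    have hs1 : (v t)⁻¹ - v t ≠ 0 := fun h => hs0 (by simp [h])
    have hs2 : 1 - v t ^ 2 ≠ 0 := by
      intro h
      apply hs1
      field_simp [hv0 t]
      linear_combination h
    have := hv1 t
    have := hv2 t
    have := hv0 t
    have := Complex.I_ne_zero
    have hs3 : (v t)⁻¹ - v t = (1 - v t ^ 2) / v t := by field_simp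
    rw [hs3, Pi.div_apply]
    field_simp
    ring
  have hnorm : ∀ t, ‖v t‖ = Real.exp (-(π * t)) := by
    intro t
    rw [hv, Complex.norm_exp]; simp
  have hpt : Filter.Tendsto (fun t : ℝ => π * t) Filter.atTop Filter.atTop :=
    Filter.tendsto_id.const_mul_atTop Real.pi_pos
  have hpb : Filter.Tendsto (fun t : ℝ => π * t) Filter.atBot Filter.atBot :=
    Filter.tendsto_id.const_mul_atBot Real.pi_pos
  have hvtop : Filter.Tendsto v Filter.atTop (nhds 0) := by
    rw [tendsto_zero_iff_norm_tendsto_zero]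
    simp_rw [hnorm]
    exact Real.tendsto_exp_neg_atTop_nhds_zero.comp hpt
  have hvbot : Filter.Tendsto (fun t => (v t)⁻¹) Filter.atBot (nhds 0) := by
    rw [tendsto_zero_iff_norm_tendsto_zero]
    simp_rw [norm_inv, hnorm, Real.exp_neg, inv_inv]
    exact Real.tendsto_exp_atBot.comp hpb
  have hqtop : Filter.Tendsto q Filter.atTop (nhds Complex.I) := by
    have h := ((hvtop.sub_const 1).div (hvtop.add_const 1) (by norm_num)).const_mul (-Complex.I)
    have e : -Complex.I * ((0 - 1) / (0 + 1)) = Complex.I := by norm_num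
    rw [e] at h
    exact h
  have hqbot : Filter.Tendsto q Filter.atBot (nhds (-Complex.I)) := by
    have h := ((hvbot.const_sub 1).div (hvbot.const_add 1) (by norm_num)).const_mul (-Complex.I)
    have e : -Complex.I * ((1 - 0) / (1 + 0)) = -Complex.I := by norm_num
    rw [e] at h
    refine h.congr fun t => ?_
    have := hv0 t
    have h1' : 1 + (v t)⁻¹ = (v t + 1) / v t := by field_simp
    have h2' : 1 - (v t)⁻¹ = (v t - 1) / v t := by field_simp
    simp only [hq, Pi.div_apply]
    rw [h1', h2', div_div_div_cancel_right₀ this]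
  have hI := integral_of_hasDerivAt_of_tendsto hd ((integrable_pi_div_sin h0 h1).const_mul _)
    ((continuousAt_clog (by simp [Complex.slitPlane])).tendsto.comp hqbot)
    ((continuousAt_clog (by simp [Complex.slitPlane])).tendsto.comp hqtop)
  rw [integral_const_mul, Complex.log_I, Complex.log_neg_I] at hI
  apply mul_left_cancel₀ Complex.I_ne_zero
  rw [hI]
  ring

/-- The residue of `π / sin (π z) * G z` at `0`, collected by moving the line of integration from
`Re z = a` to `Re z = a - 1`. -/
theorem integral_pi_div_sin_mul_shift {G : ℂ → ℂ} {a δ : ℝ} (h0 : 0 < a) (h1 : a < 1) (hδ : a < δ)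
    (hG : DifferentiableOn ℂ G {z | z.re < δ}) (B : ℝ → ℝ)
    (hB : Filter.Tendsto B Filter.atTop (nhds 0))
    (hbd : ∀ z : ℂ, a - 1 ≤ z.re → z.re ≤ a → ‖G z‖ ≤ Real.exp (π * |z.im|) * B |z.im|)
    (hi0 : Integrable fun t : ℝ =>
      (π : ℂ) / Complex.sin (π * (a + t * Complex.I)) * G (a + t * Complex.I))
    (hi1 : Integrable fun t : ℝ =>
      (π : ℂ) / Complex.sin (π * (a + t * Complex.I)) * G (a + t * Complex.I - 1)) :
    (∫ t : ℝ, (π : ℂ) / Complex.sin (π * (a + t * Complex.I)) * G (a + t * Complex.I)) +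
      ∫ t : ℝ, (π : ℂ) / Complex.sin (π * (a + t * Complex.I)) * G (a + t * Complex.I - 1) =
      2 * π * G 0 := by
  set S : ℂ → ℂ := fun z => Complex.sin (π * z) / π with hS
  set K : ℂ → ℂ := fun z => dslope G 0 z / dslope S 0 z with hK
  have hpi : (π : ℂ) ≠ 0 := by exact_mod_cast Real.pi_ne_zero
  have hS0 : S 0 = 0 := by simp [hS]
  have hSd : Differentiable ℂ S := by simp only [hS]; fun_prop
  have hSd' : HasDerivAt S 1 0 := by
    have h : HasDerivAt (fun z : ℂ => (π : ℂ) * z) (π * 1) 0 := (hasDerivAt_id _).const_mul _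
    refine (h.csin.div_const (π : ℂ)).congr_deriv ?_
    simp [hpi]
  have hKne : ∀ z : ℂ, z ≠ 0 →
      K z = π / Complex.sin (π * z) * (G z - G 0) := by
    intro z hz
    simp only [hK]
    rw [dslope_of_ne _ hz, dslope_of_ne _ hz, slope_def_field, slope_def_field, hS0, sub_zero,
      sub_zero, div_div_div_cancel_right₀ hz, hS, div_div_eq_mul_div, mul_comm (π : ℂ),
      mul_div_assoc, mul_comm]
  have hSne : ∀ z : ℂ, a - 1 ≤ z.re → z.re ≤ a → dslope S 0 z ≠ 0 := by
    intro z hz1 hz2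
    by_cases hz : z = 0
    · rw [hz, dslope_same, hSd'.deriv]; exact one_ne_zero
    · rw [dslope_of_ne _ hz, slope_def_field, hS0, sub_zero, sub_zero, hS]
      refine div_ne_zero (div_ne_zero (fun h => ?_) hpi) hz
      obtain ⟨k, hk⟩ := Complex.sin_eq_zero_iff.1 h
      have hzk : z = k := mul_left_cancel₀ hpi (hk.trans (mul_comm _ _))
      have hk1 : (-1 : ℝ) < k := by
        have := congrArg Complex.re hzk
        rw [Complex.intCast_re] at this
        linarith
      have hk2 : (k : ℝ) < 1 := by
        have := congrArg Complex.re hzk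
        rw [Complex.intCast_re] at this
        linarith
      have hk1' : -1 < k := by exact_mod_cast hk1
      have hk2' : k < 1 := by exact_mod_cast hk2
      have : k = 0 := by omega
      rw [this] at hzk
      exact hz (by simpa using hzk)
  have hU : {z : ℂ | z.re < δ} ∈ nhds (0 : ℂ) :=
    (isOpen_lt Complex.continuous_re continuous_const).mem_nhds (by simp; linarith)
  have hKd : DifferentiableOn ℂ K {z | a - 1 ≤ z.re ∧ z.re ≤ a} := by
    refine DifferentiableOn.div ?_ ?_ fun z hz => hSne z hz.1 hz.2
    · exact ((Complex.differentiableOn_dslope hU).2 hG).mono fun z hz => lt_of_le_of_lt hz.2 hδ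
    · exact ((Complex.differentiableOn_dslope Filter.univ_mem).2 hSd.differentiableOn).mono
        (Set.subset_univ _)
  have hline : ∀ t : ℝ, (a + t * Complex.I : ℂ) ≠ 0 := fun t h => by
    have := congrArg Complex.re h
    simp at this
    exact h0.ne' this
  have hline1 : ∀ t : ℝ, (a + t * Complex.I - 1 : ℂ) ≠ 0 := fun t h => by
    have := congrArg Complex.re h
    simp at this
    linarith
  have hs := integrable_pi_div_sin h0 h1
  have hKb : ∀ t : ℝ, K (a + t * Complex.I) =
      (π : ℂ) / Complex.sin (π * (a + t * Complex.I)) * G (a + t * Complex.I) -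
        (π : ℂ) / Complex.sin (π * (a + t * Complex.I)) * G 0 := fun t => by
    rw [hKne _ (hline t), mul_sub]
  have hKa : ∀ t : ℝ, K ((a - 1 : ℝ) + t * Complex.I) =
      (π : ℂ) / Complex.sin (π * (a + t * Complex.I)) * G 0 -
      (π : ℂ) / Complex.sin (π * (a + t * Complex.I)) * G (a + t * Complex.I - 1) := fun t => by
    have e : ((a - 1 : ℝ) + t * Complex.I : ℂ) = a + t * Complex.I - 1 := by push_cast; ring
    have e2 : Complex.sin (π * (a + t * Complex.I - 1)) =
        -Complex.sin (π * (a + t * Complex.I)) := by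
      rw [mul_sub, mul_one, Complex.sin_sub_pi]
    rw [e, hKne _ (hline1 t), e2, div_neg]
    ring
  have key := integral_vertical_eq (f := K) (a := a - 1) (b := a) (by linarith)
    (fun y => (B y + Real.exp (-(π * y)) * ‖G 0‖) *
      (π * (2 / (1 - Real.exp (-(2 * π))))) ) ?_ hKd ?_ ?_ ?_
  · simp_rw [hKa, hKb] at key
    rw [integral_sub (hs.mul_const _) hi1, integral_sub hi0 (hs.mul_const _),
      integral_mul_const, integral_pi_div_sin h0 h1] at key
    linear_combination -key
  · have h1 : Filter.Tendsto (fun y : ℝ => Real.exp (-(π * y))) Filter.atTop (nhds 0) :=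
      Real.tendsto_exp_neg_atTop_nhds_zero.comp (Filter.tendsto_id.const_mul_atTop Real.pi_pos)
    simpa using (hB.add (h1.mul_const ‖G 0‖)).mul_const (π * (2 / (1 - Real.exp (-(2 * π)))))
  · simp_rw [hKa]
    exact (hs.mul_const _).sub hi1
  · simp_rw [hKb]
    exact hi0.sub (hs.mul_const _)
  · intro z hz1 hz2 hz3
    have hz : z ≠ 0 := by
      rintro rfl
      norm_num at hz3
    rw [hKne z hz, norm_mul, norm_div, Complex.norm_real, Real.norm_of_nonneg Real.pi_pos.le]
    set y := |z.im| with hy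
    have hE : 0 < 1 - Real.exp (-(2 * π)) := by
      rw [sub_pos, Real.exp_lt_one_iff]
      linarith [Real.pi_pos]
    have hsin : Real.exp (π * y) * ((1 - Real.exp (-(2 * π))) / 2) ≤ ‖Complex.sin (π * z)‖ := by
      refine le_trans ?_ (abs_sinh_le_norm_sin _)
      have him : (π * z : ℂ).im = π * z.im := by simp
      rw [him, Real.abs_sinh, abs_mul, abs_of_pos Real.pi_pos, ← hy, Real.sinh_eq]
      have : Real.exp (-(π * y)) ≤ Real.exp (π * y) * Real.exp (-(2 * π)) := by
        rw [← Real.exp_add, Real.exp_le_exp]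
        nlinarith [Real.pi_pos]
      linarith
    have hG' : ‖G z - G 0‖ ≤ Real.exp (π * y) * (B y + Real.exp (-(π * y)) * ‖G 0‖) := by
      have e : Real.exp (π * y) * Real.exp (-(π * y)) = 1 := by rw [← Real.exp_add]; simp
      calc ‖G z - G 0‖ ≤ ‖G z‖ + ‖G 0‖ := norm_sub_le _ _
        _ ≤ Real.exp (π * y) * B y + ‖G 0‖ := by gcongr; exact hbd z hz1 hz2
        _ = _ := by linear_combination (-‖G 0‖) * e
    have hexp := Real.exp_pos (π * y)
    calc π / ‖Complex.sin (π * z)‖ * ‖G z - G 0‖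
        ≤ π / (Real.exp (π * y) * ((1 - Real.exp (-(2 * π))) / 2)) *
          (Real.exp (π * y) * (B y + Real.exp (-(π * y)) * ‖G 0‖)) := by
          gcongr
      _ = _ := by field_simp

/-- Iterated residue evaluation of `∫ π / sin (π z) * G z` along `Re z = a`. -/
theorem integral_pi_div_sin_mul_eq_sum {G : ℂ → ℂ} {a δ : ℝ} (h0 : 0 < a) (h1 : a < 1)
    (hδ : a < δ) (hG : DifferentiableOn ℂ G {z | z.re < δ})
    (hbd : ∀ n : ℕ, ∃ B : ℝ → ℝ, Filter.Tendsto B Filter.atTop (nhds 0) ∧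
      ∀ z : ℂ, a - 1 - n ≤ z.re → z.re ≤ a - n → ‖G z‖ ≤ Real.exp (π * |z.im|) * B |z.im|)
    (hi : ∀ n : ℕ, Integrable fun t : ℝ =>
      (π : ℂ) / Complex.sin (π * (a + t * Complex.I)) * G (a + t * Complex.I - n)) (N : ℕ) :
    ∫ t : ℝ, (π : ℂ) / Complex.sin (π * (a + t * Complex.I)) * G (a + t * Complex.I) =
      2 * π * ∑ n ∈ Finset.range N, (-1) ^ n * G (-n) + (-1) ^ N *
      ∫ t : ℝ, (π : ℂ) / Complex.sin (π * (a + t * Complex.I)) * G (a + t * Complex.I - N) := by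
  induction N with
  | zero => simp
  | succ N ih =>
    obtain ⟨B, hB, hB'⟩ := hbd N
    have hi' : Integrable fun t : ℝ => (π : ℂ) / Complex.sin (π * (a + t * Complex.I)) *
        G (a + t * Complex.I - 1 - N) := by
      refine (hi (N + 1)).congr (Filter.Eventually.of_forall fun t => ?_)
      simp only; congr 2; push_cast; ring
    have hstep := integral_pi_div_sin_mul_shift (G := fun z => G (z - N)) h0 h1 hδ
      (hG.comp (by fun_prop) fun z hz => by
        have h1 : z.re < δ := hz
        have h2 : (0 : ℝ) ≤ N := Nat.cast_nonneg N
        simp only [Set.mem_ofPred_eq, Complex.sub_re, Complex.natCast_re]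
        linarith) B hB
      (fun z hz1 hz2 => by
        have := hB' (z - N) (by simp; linarith) (by simp; linarith)
        simpa using this) (hi N) hi'
    have e : ∀ t : ℝ, (a + t * Complex.I - (N + 1 : ℕ) : ℂ) = a + t * Complex.I - 1 - N := by
      intro t; push_cast; ring
    simp_rw [e]
    rw [ih, Finset.sum_range_succ, pow_succ]
    simp only [zero_sub] at hstep
    linear_combination (-1) ^ N * hstep

/-- The holomorphic factor left after splitting `π / sin` off the Mellin–Barnes integrand. -/
noncomputable def besselSqKernel (x τ : ℝ) (z : ℂ) : ℂ :=
  Complex.Gamma (1 / 2 + Complex.I * τ - z) * (x : ℂ) ^ (Complex.I * τ - z) /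
    (Complex.Gamma (1 + Complex.I * τ - z) * Complex.Gamma (1 - z) *
      Complex.Gamma (1 + 2 * (Complex.I * τ) - z))

theorem differentiableOn_besselSqKernel {x : ℝ} (hx : 0 < x) (τ : ℝ) :
    DifferentiableOn ℂ (besselSqKernel x τ) {z | z.re < 1 / 2} := by
  intro z hz
  have hz' : z.re < 1 / 2 := hz
  have hx' : (x : ℂ) ≠ 0 := by exact_mod_cast hx.ne'
  have hG : ∀ w : ℂ, z.re < w.re →
      DifferentiableAt ℂ (fun z => Complex.Gamma (w - z)) z := by
    intro w hw
    have : DifferentiableAt ℂ Complex.Gamma (w - z) :=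
      Complex.differentiableAt_Gamma _ fun m h => by
        have := congrArg Complex.re h
        simp at this
        have : (0 : ℝ) ≤ m := Nat.cast_nonneg m
        linarith
    exact this.comp z (by fun_prop)
  have hne : ∀ w : ℂ, z.re < w.re → Complex.Gamma (w - z) ≠ 0 := fun w hw =>
    Complex.Gamma_ne_zero_of_re_pos (by simpa using hw)
  refine DifferentiableAt.differentiableWithinAt ?_
  unfold besselSqKernel
  refine DifferentiableAt.div ((hG _ (by simpa using hz')).mul ?_)
    (((hG _ (by simp; linarith)).mul (hG _ (by simp; linarith))).mul
      (hG _ (by simp; linarith))) ?_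
  · exact DifferentiableAt.const_cpow (by fun_prop) (Or.inl hx')
  · exact mul_ne_zero (mul_ne_zero (hne _ (by simp; linarith)) (hne _ (by simp; linarith)))
      (hne _ (by simp; linarith))

theorem norm_besselSqKernel {x : ℝ} (hx : 0 < x) (τ : ℝ) (z : ℂ) :
    ‖besselSqKernel x τ z‖ =
      ‖Complex.Gamma ((1 / 2 - z.re : ℝ) + (τ - z.im : ℝ) * Complex.I)‖ * x ^ (-z.re) /
      (‖Complex.Gamma ((1 - z.re : ℝ) + (τ - z.im : ℝ) * Complex.I)‖ *
        ‖Complex.Gamma ((1 - z.re : ℝ) + (-z.im : ℝ) * Complex.I)‖ *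
        ‖Complex.Gamma ((1 - z.re : ℝ) + (2 * τ - z.im : ℝ) * Complex.I)‖) := by
  have e1 : (1 / 2 + Complex.I * τ - z : ℂ) =
      (1 / 2 - z.re : ℝ) + (τ - z.im : ℝ) * Complex.I := by
    apply Complex.ext <;> simp
  have e2 : (1 + Complex.I * τ - z : ℂ) = (1 - z.re : ℝ) + (τ - z.im : ℝ) * Complex.I := by
    apply Complex.ext <;> simp
  have e3 : (1 - z : ℂ) = (1 - z.re : ℝ) + (-z.im : ℝ) * Complex.I := by
    apply Complex.ext <;> simp
  have e4 : (1 + 2 * (Complex.I * τ) - z : ℂ) =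
      (1 - z.re : ℝ) + (2 * τ - z.im : ℝ) * Complex.I := by
    apply Complex.ext <;> simp
  have e5 : (Complex.I * τ - z).re = -z.re := by simp
  rw [besselSqKernel, norm_div, norm_mul, norm_mul, norm_mul,
    Complex.norm_cpow_eq_rpow_re_of_pos hx, e1, e2, e3, e4, e5]

theorem exp_neg_pi_mul_abs_sub_le (s t : ℝ) :
    Real.exp (-(π * |t| / 2)) ≤ Real.exp (π * |s| / 2) * Real.exp (-(π * |s - t| / 2)) := by
  rw [← Real.exp_add, Real.exp_le_exp]
  have : |s - t| ≤ |s| + |t| := abs_sub _ _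
  nlinarith [Real.pi_pos]

theorem one_add_abs_rpow_sub_le (s t : ℝ) {p : ℝ} (hp : 0 ≤ p) :
    (1 + |t|) ^ p ≤ (1 + |s|) ^ p * (1 + |s - t|) ^ p := by
  rw [← Real.mul_rpow (by positivity) (by positivity)]
  apply Real.rpow_le_rpow (by positivity) _ hp
  have : |t| ≤ |s| + |s - t| := by
    have := abs_sub s (s - t)
    simpa using this
  nlinarith [abs_nonneg s, abs_nonneg (s - t)]

/-- `‖Γ(v + i(s - t))‖` is bounded below as `‖Γ(v + it)‖` is, with a constant depending on `s`. -/
theorem le_norm_Gamma_sub {v : ℝ} (h1 : 1 / 2 ≤ v) (h2 : v ≤ 1) (s : ℝ) :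
    ∃ c > 0, ∀ t : ℝ, c * ((1 + |t|) ^ (v - 1 / 2) * Real.exp (-(π * |t| / 2))) ≤
      ‖Complex.Gamma (v + (s - t : ℝ) * Complex.I)‖ := by
  obtain ⟨c, hc, h⟩ := le_norm_Gamma h1 h2
  refine ⟨c * ((1 + |s|) ^ (v - 1 / 2))⁻¹ * (Real.exp (π * |s| / 2))⁻¹, by positivity,
    fun t => le_trans ?_ (h (s - t))⟩
  have e1 := exp_neg_pi_mul_abs_sub_le s t
  have e2 := one_add_abs_rpow_sub_le s t (sub_nonneg.2 h1)
  have hs : 0 < (1 + |s|) ^ (v - 1 / 2) := by positivity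
  have e3 := Real.exp_pos (π * |s| / 2)
  calc _ = c * (((1 + |t|) ^ (v - 1 / 2) / (1 + |s|) ^ (v - 1 / 2)) *
        (Real.exp (-(π * |t| / 2)) / Real.exp (π * |s| / 2))) := by field_simp
    _ ≤ _ := by
      gcongr
      · rwa [div_le_iff₀' hs]
      · rwa [div_le_iff₀' e3]

theorem exists_norm_besselSqKernel_le {x : ℝ} (hx : 0 < x) (τ : ℝ) {a b : ℝ} (hb : b ≤ 1 / 4) :
    ∃ B : ℝ → ℝ, Filter.Tendsto B Filter.atTop (nhds 0) ∧
      ∀ z : ℂ, a ≤ z.re → z.re ≤ b →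
        ‖besselSqKernel x τ z‖ ≤ Real.exp (π * |z.im|) * B |z.im| := by
  obtain ⟨c1, hc1, h1⟩ := le_norm_Gamma_sub (v := 3 / 4) (by norm_num) (by norm_num) 0
  obtain ⟨c2, hc2, h2⟩ := le_norm_Gamma_sub (v := 3 / 4) (by norm_num) (by norm_num) (2 * τ)
  have hcont : ContinuousOn (fun r : ℝ => Real.Gamma (1 / 2 - r) * x ^ (-r) /
      (Real.Gamma (1 - r) * (Real.Gamma (1 - r) / Real.Gamma (3 / 4)) *
        (Real.Gamma (1 - r) / Real.Gamma (3 / 4)))) (Set.Icc a b) := by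
    have hG : ∀ w : ℝ, b < w → ContinuousOn (fun r : ℝ => Real.Gamma (w - r)) (Set.Icc a b) := by
      intro w hw r hr
      have : ContinuousAt Real.Gamma (w - r) :=
        (Real.differentiableAt_Gamma fun m h => by
          have : (0 : ℝ) ≤ m := Nat.cast_nonneg m
          linarith [hr.2]).continuousAt
      exact (ContinuousAt.comp (f := fun r => w - r) this (by fun_prop)).continuousWithinAt
    have hG1 := hG 1 (by linarith)
    refine ContinuousOn.div ((hG _ (by linarith)).mul ?_)
      ((hG1.mul (hG1.div_const _)).mul (hG1.div_const _)) fun r hr => ?_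
    · exact ContinuousOn.rpow continuousOn_const (by fun_prop) fun r _ => Or.inl hx.ne'
    · have := Real.Gamma_pos_of_pos (show 0 < 1 - r by linarith [hr.2])
      have := Real.Gamma_pos_of_pos (show (0 : ℝ) < 3 / 4 by norm_num)
      positivity
  obtain ⟨M, hM⟩ := isCompact_Icc.exists_bound_of_continuousOn hcont
  refine ⟨fun y => M * (c1 * c2)⁻¹ * (1 + y) ^ (-(1 / 2) : ℝ), ?_, fun z hz1 hz2 => ?_⟩
  · have h := (tendsto_rpow_neg_atTop (show (0 : ℝ) < 1 / 2 by norm_num)).comp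
      (Filter.tendsto_atTop_add_const_left Filter.atTop (1 : ℝ) Filter.tendsto_id)
    simpa using h.const_mul (M * (c1 * c2)⁻¹)
  · rw [norm_besselSqKernel hx]
    set r := z.re
    set y := z.im
    have hM' := (le_abs_self _).trans (hM r ⟨hz1, hz2⟩)
    have g0 := Real.Gamma_pos_of_pos (show 0 < 1 / 2 - r by linarith)
    have g1 := Real.Gamma_pos_of_pos (show 0 < 1 - r by linarith)
    have g2 := Real.Gamma_pos_of_pos (show (0 : ℝ) < 3 / 4 by norm_num)
    have m0 := norm_Gamma_div_Gamma_mono (τ - y) (show 0 < 1 / 2 - r by linarith)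
      (show 1 / 2 - r ≤ 1 - r by linarith)
    have low : ∀ t d : ℝ, d ≤ ‖Complex.Gamma ((3 / 4 : ℝ) + (t : ℝ) * Complex.I)‖ →
        Real.Gamma (1 - r) / Real.Gamma (3 / 4) * d ≤
          ‖Complex.Gamma ((1 - r : ℝ) + (t : ℝ) * Complex.I)‖ := by
      intro t d hd
      have m := norm_Gamma_div_Gamma_mono t (show (0 : ℝ) < 3 / 4 by norm_num)
        (show 3 / 4 ≤ 1 - r by linarith)
      rw [div_le_div_iff₀ g2 g1] at m
      rw [div_mul_eq_mul_div, div_le_iff₀ g2]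
      nlinarith
    have l1 := low _ _ (h1 y)
    have l2 := low _ _ (h2 y)
    rw [zero_sub] at l1
    have hpos : 0 < ‖Complex.Gamma ((1 - r : ℝ) + (τ - y : ℝ) * Complex.I)‖ :=
      norm_pos_iff.2 (Complex.Gamma_ne_zero_of_re_pos (by simp; linarith))
    have m1 : ‖Complex.Gamma ((1 / 2 - r : ℝ) + (τ - y : ℝ) * Complex.I)‖ /
        ‖Complex.Gamma ((1 - r : ℝ) + (τ - y : ℝ) * Complex.I)‖ ≤
        Real.Gamma (1 / 2 - r) / Real.Gamma (1 - r) := by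
      rw [div_le_div_iff₀ g0 g1] at m0
      rw [div_le_div_iff₀ hpos g1]
      linarith
    have hP : (0 : ℝ) < (1 + |y|) ^ (3 / 4 - 1 / 2 : ℝ) := by positivity
    have hE := Real.exp_pos (-(π * |y| / 2))
    have hEE : Real.exp (π * |y|) = (Real.exp (-(π * |y| / 2)))⁻¹ ^ 2 := by
      rw [← Real.exp_neg, ← Real.exp_nat_mul]; congr 1; push_cast; ring
    have hPP : (1 + |y|) ^ (-(1 / 2) : ℝ) = ((1 + |y|) ^ (3 / 4 - 1 / 2 : ℝ))⁻¹ ^ 2 := by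
      rw [← Real.rpow_neg (by positivity), ← Real.rpow_mul_natCast (by positivity)]
      congr 1; norm_num
    set P := (1 + |y|) ^ (3 / 4 - 1 / 2 : ℝ)
    set E := Real.exp (-(π * |y| / 2))
    set gA := ‖Complex.Gamma ((1 / 2 - r : ℝ) + (τ - y : ℝ) * Complex.I)‖
    set gB := ‖Complex.Gamma ((1 - r : ℝ) + (τ - y : ℝ) * Complex.I)‖
    set gC := ‖Complex.Gamma ((1 - r : ℝ) + (-y : ℝ) * Complex.I)‖
    set gD := ‖Complex.Gamma ((1 - r : ℝ) + (2 * τ - y : ℝ) * Complex.I)‖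
    set q := Real.Gamma (1 - r) / Real.Gamma (3 / 4)
    have hq : 0 < q := by positivity
    have hx0 : 0 < x ^ (-r) := by positivity
    calc gA * x ^ (-r) / (gB * gC * gD) = (gA / gB) * x ^ (-r) / (gC * gD) := by field_simp
      _ ≤ (Real.Gamma (1 / 2 - r) / Real.Gamma (1 - r)) * x ^ (-r) /
          ((q * (c1 * (P * E))) * (q * (c2 * (P * E)))) := by gcongr
      _ = (Real.Gamma (1 / 2 - r) * x ^ (-r) / (Real.Gamma (1 - r) * q * q)) *
          ((c1 * c2)⁻¹ * (P⁻¹ ^ 2 * E⁻¹ ^ 2)) := by field_simp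
      _ ≤ M * ((c1 * c2)⁻¹ * (P⁻¹ ^ 2 * E⁻¹ ^ 2)) := by gcongr
      _ = _ := by beta_reduce; rw [hEE, hPP]; ring

theorem norm_besselSqKernel_vertical_le {x : ℝ} (hx : 0 < x) (τ : ℝ) {γ : ℝ} (h0 : 0 < γ)
    (h1 : γ < 1 / 2) :
    ∃ C, ∀ t : ℝ, ‖besselSqKernel x τ (γ + t * Complex.I)‖ ≤
      C * Real.exp (π * |t|) * (1 + |t|) ^ (-(3 / 2 - 2 * γ)) := by
  obtain ⟨c0, hc0, hA⟩ := norm_Gamma_le (w := 1 / 2 - γ) (by linarith) (by linarith)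
  obtain ⟨c, hc, hB⟩ := le_norm_Gamma (v := 1 - γ) (by linarith) (by linarith)
  obtain ⟨c1, hc1, hC⟩ := le_norm_Gamma_sub (v := 1 - γ) (by linarith) (by linarith) 0
  obtain ⟨c2, hc2, hD⟩ := le_norm_Gamma_sub (v := 1 - γ) (by linarith) (by linarith) (2 * τ)
  refine ⟨c0 / c * (1 + |τ|) ^ (1 / 2 : ℝ) * x ^ (-γ) * (c1 * c2)⁻¹, fun t => ?_⟩
  rw [norm_besselSqKernel hx]
  have er : ((γ : ℂ) + t * Complex.I).re = γ := by simp
  have ei : ((γ : ℂ) + t * Complex.I).im = t := by simp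
  rw [er, ei]
  have lA := hA (τ - t)
  have lB := hB (τ - t)
  have lC := hC t
  have lD := hD t
  rw [zero_sub] at lC
  have hS := one_add_abs_rpow_sub_le τ t (show (0 : ℝ) ≤ 1 / 2 by norm_num)
  have hEE : Real.exp (π * |t|) = (Real.exp (-(π * |t| / 2)))⁻¹ ^ 2 := by
    rw [← Real.exp_neg, ← Real.exp_nat_mul]; congr 1; push_cast; ring
  have hPP : (1 + |t|) ^ (-(3 / 2 - 2 * γ)) =
      ((1 + |t|) ^ (1 / 2 : ℝ))⁻¹ * ((1 + |t|) ^ (1 - γ - 1 / 2))⁻¹ ^ 2 := by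
    rw [← Real.rpow_neg (by positivity), ← Real.rpow_neg (by positivity),
      ← Real.rpow_mul_natCast (by positivity), ← Real.rpow_add (by positivity)]
    congr 1; push_cast; ring
  have hRR : (1 + |τ - t|) ^ (1 / 2 - γ - 1 / 2) =
      (1 + |τ - t|) ^ (1 - γ - 1 / 2) * ((1 + |τ - t|) ^ (1 / 2 : ℝ))⁻¹ := by
    rw [← Real.rpow_neg (by positivity), ← Real.rpow_add (by positivity)]
    congr 1; ring
  rw [hRR] at lA
  have hE := Real.exp_pos (-(π * |t| / 2))
  have hE' := Real.exp_pos (-(π * |τ - t| / 2))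
  have hP : 0 < (1 + |t|) ^ (1 - γ - 1 / 2) := by positivity
  have hR : 0 < (1 + |τ - t|) ^ (1 - γ - 1 / 2) := by positivity
  have hx0 : 0 < x ^ (-γ) := by positivity
  have hT : 0 < (1 + |t|) ^ (1 / 2 : ℝ) := by positivity
  have hU : 0 < (1 + |τ - t|) ^ (1 / 2 : ℝ) := by positivity
  have hV : 0 < (1 + |τ|) ^ (1 / 2 : ℝ) := by positivity
  rw [hEE, hPP]
  set P := (1 + |t|) ^ (1 - γ - 1 / 2)
  set E := Real.exp (-(π * |t| / 2))
  set E' := Real.exp (-(π * |τ - t| / 2))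
  set R := (1 + |τ - t|) ^ (1 - γ - 1 / 2)
  set T := (1 + |t|) ^ (1 / 2 : ℝ)
  set U := (1 + |τ - t|) ^ (1 / 2 : ℝ)
  set V := (1 + |τ|) ^ (1 / 2 : ℝ)
  set gA := ‖Complex.Gamma ((1 / 2 - γ : ℝ) + (τ - t : ℝ) * Complex.I)‖
  set gB := ‖Complex.Gamma ((1 - γ : ℝ) + (τ - t : ℝ) * Complex.I)‖
  set gC := ‖Complex.Gamma ((1 - γ : ℝ) + (-t : ℝ) * Complex.I)‖
  set gD := ‖Complex.Gamma ((1 - γ : ℝ) + (2 * τ - t : ℝ) * Complex.I)‖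
  have hUT : U⁻¹ ≤ V * T⁻¹ := by
    rw [inv_le_iff_one_le_mul₀ hU]
    field_simp
    linarith
  calc gA * x ^ (-γ) / (gB * gC * gD)
      ≤ (c0 * (R * U⁻¹ * E')) * x ^ (-γ) /
        ((c * (R * E')) * (c1 * (P * E)) * (c2 * (P * E))) := by gcongr
    _ = (c0 / c) * U⁻¹ * x ^ (-γ) * (c1 * c2)⁻¹ * (P⁻¹ ^ 2 * E⁻¹ ^ 2) := by field_simp
    _ ≤ (c0 / c) * (V * T⁻¹) * x ^ (-γ) * (c1 * c2)⁻¹ * (P⁻¹ ^ 2 * E⁻¹ ^ 2) := by gcongr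
    _ = _ := by ring

theorem besselSqKernel_sub_one {x : ℝ} (hx : 0 < x) (τ : ℝ) {z : ℂ} (hz : z.re < 1 / 2) :
    besselSqKernel x τ (z - 1) = besselSqKernel x τ z * (x * (1 / 2 + Complex.I * τ - z) /
      ((1 + Complex.I * τ - z) * (1 - z) * (1 + 2 * (Complex.I * τ) - z))) := by
  have hx' : (x : ℂ) ≠ 0 := by exact_mod_cast hx.ne'
  have hne : ∀ w : ℂ, 0 < w.re → w ≠ 0 := by
    rintro w hw rfl
    simp at hw
  have n1 := hne (1 / 2 + Complex.I * τ - z) (by simp; linarith)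
  have n2 := hne (1 + Complex.I * τ - z) (by simp; linarith)
  have n3 := hne (1 - z) (by simp; linarith)
  have n4 := hne (1 + 2 * (Complex.I * τ) - z) (by simp; linarith)
  rw [besselSqKernel, besselSqKernel,
    show 1 / 2 + Complex.I * τ - (z - 1) = 1 / 2 + Complex.I * τ - z + 1 by ring,
    show 1 + Complex.I * τ - (z - 1) = 1 + Complex.I * τ - z + 1 by ring,
    show 1 - (z - 1) = 1 - z + 1 by ring,
    show 1 + 2 * (Complex.I * τ) - (z - 1) = 1 + 2 * (Complex.I * τ) - z + 1 by ring,
    show Complex.I * τ - (z - 1) = Complex.I * τ - z + 1 by ring,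
    Complex.Gamma_add_one _ n1, Complex.Gamma_add_one _ n2, Complex.Gamma_add_one _ n3,
    Complex.Gamma_add_one _ n4, Complex.cpow_add _ _ hx', Complex.cpow_one, div_mul_div_comm]
  congr 1 <;> ring

theorem norm_besselSqKernel_sub_one_le {x : ℝ} (hx : 0 < x) (τ : ℝ) {z : ℂ} (hz : z.re < 1 / 2) :
    ‖besselSqKernel x τ (z - 1)‖ ≤ ‖besselSqKernel x τ z‖ * (x / (1 - z.re) ^ 2) := by
  rw [besselSqKernel_sub_one hx τ hz, norm_mul]
  gcongr
  rw [norm_div, norm_mul, norm_mul, norm_mul, Complex.norm_real, Real.norm_of_nonneg hx.le]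
  have h1 : ‖1 / 2 + Complex.I * τ - z‖ ≤ ‖1 + Complex.I * τ - z‖ := by
    rw [Complex.norm_def, Complex.norm_def]
    apply Real.sqrt_le_sqrt
    rw [Complex.normSq_apply, Complex.normSq_apply]
    simp
    nlinarith
  have h2 : 1 - z.re ≤ ‖1 - z‖ := by
    simpa using Complex.re_le_norm (1 - z)
  have h3 : 1 - z.re ≤ ‖1 + 2 * (Complex.I * τ) - z‖ := by
    simpa using Complex.re_le_norm (1 + 2 * (Complex.I * τ) - z)
  have h4 : 0 < ‖1 + Complex.I * τ - z‖ := by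
    have := Complex.re_le_norm (1 + Complex.I * τ - z)
    simp at this
    linarith
  have h5 : 0 < 1 - z.re := by linarith
  calc _ ≤ x * ‖1 + Complex.I * τ - z‖ / (‖1 + Complex.I * τ - z‖ * (1 - z.re) * (1 - z.re)) := by
        gcongr
    _ = _ := by field_simp

theorem norm_besselSqKernel_sub_nat_le {x : ℝ} (hx : 0 < x) (τ : ℝ) {z : ℂ} (hz : z.re < 1 / 2)
    (n : ℕ) :
    ‖besselSqKernel x τ (z - n)‖ ≤ ‖besselSqKernel x τ z‖ * ((4 * x) ^ n / n.factorial) := by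
  induction n with
  | zero => simp
  | succ n ih =>
    have hn : (0 : ℝ) ≤ n := Nat.cast_nonneg n
    have h := norm_besselSqKernel_sub_one_le hx τ (z := z - n) (by simp; linarith)
    have e : z - ((n + 1 : ℕ) : ℂ) = z - n - 1 := by push_cast; ring
    rw [e]
    have hr : (z - n).re = z.re - n := by simp
    rw [hr] at h
    have h2 : x / (1 - (z.re - n)) ^ 2 ≤ 4 * x / (n + 1) := by
      rw [div_le_div_iff₀ (by nlinarith) (by positivity)]
      have : (n : ℝ) + 1 ≤ 4 * (1 - (z.re - n)) ^ 2 := by nlinarith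
      nlinarith
    calc _ ≤ _ := h
      _ ≤ (‖besselSqKernel x τ z‖ * ((4 * x) ^ n / n.factorial)) * (4 * x / (n + 1)) := by gcongr
      _ = _ := by
        rw [Nat.factorial_succ]
        push_cast
        field_simp
        ring

theorem integrable_pi_div_sin_mul_besselSqKernel {x : ℝ} (hx : 0 < x) (τ : ℝ) {γ : ℝ}
    (h0 : 0 < γ) (h1 : γ < 1 / 4) (n : ℕ) :
    Integrable fun t : ℝ => (π : ℂ) / Complex.sin (π * (γ + t * Complex.I)) *
      besselSqKernel x τ (γ + t * Complex.I - n) := by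
  obtain ⟨C, hC⟩ := norm_besselSqKernel_vertical_le hx τ h0 (by linarith)
  refine integrable_of_norm_le_one_add_abs_rpow (r := 3 / 2 - 2 * γ)
    (C := 2 * π / Real.sin (π * γ) * C * ((4 * x) ^ n / n.factorial))
    ?_ (by linarith) fun t => ?_
  · refine (continuous_pi_div_sin h0 (by linarith)).mul ?_
    refine (differentiableOn_besselSqKernel hx τ).continuousOn.comp_continuous (by fun_prop)
      fun t => ?_
    have hn : (0 : ℝ) ≤ n := Nat.cast_nonneg n
    simp only [Set.mem_ofPred_eq]
    simp
    linarith
  · have hs := norm_pi_div_sin_le h0 (show γ < 1 by linarith) t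
    have hk := norm_besselSqKernel_sub_nat_le hx τ (z := γ + t * Complex.I) (by simp; linarith) n
    have hsin : 0 < Real.sin (π * γ) :=
      Real.sin_pos_of_pos_of_lt_pi (by positivity) (by nlinarith [Real.pi_pos])
    rw [norm_mul]
    calc _ ≤ (2 * π / Real.sin (π * γ) * Real.exp (-(π * |t|))) *
          ((C * Real.exp (π * |t|) * (1 + |t|) ^ (-(3 / 2 - 2 * γ))) *
            ((4 * x) ^ n / n.factorial)) := by
          gcongr
          exact hk.trans (by gcongr; exact hC t)
      _ = _ := by
          rw [Real.exp_neg]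
          field_simp

theorem tendsto_sum_besselSqKernel {x : ℝ} (hx : 0 < x) (τ : ℝ) {γ : ℝ}
    (h0 : 0 < γ) (h1 : γ < 1 / 4) :
    Filter.Tendsto (fun N : ℕ => 2 * (π : ℂ) *
      ∑ n ∈ Finset.range N, (-1 : ℂ) ^ n * besselSqKernel x τ (-n)) Filter.atTop
      (nhds (∫ t : ℝ, (π : ℂ) / Complex.sin (π * (γ + t * Complex.I)) *
        besselSqKernel x τ (γ + t * Complex.I))) := by
  have key := integral_pi_div_sin_mul_eq_sum (G := besselSqKernel x τ) (δ := 1 / 2) h0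
    (by linarith) (by linarith) (differentiableOn_besselSqKernel hx τ)
    (fun n => exists_norm_besselSqKernel_le hx τ
      (by have : (0 : ℝ) ≤ n := Nat.cast_nonneg n
          linarith))
    (integrable_pi_div_sin_mul_besselSqKernel hx τ h0 h1)
  set F : ℕ → ℝ → ℂ := fun n t => (π : ℂ) / Complex.sin (π * (γ + t * Complex.I)) *
      besselSqKernel x τ (γ + t * Complex.I - n) with hF
  have hint : Integrable (F 0) := integrable_pi_div_sin_mul_besselSqKernel hx τ h0 h1 0
  have hrem : Filter.Tendsto (fun N : ℕ => (-1 : ℂ) ^ N * ∫ t, F N t) Filter.atTop (nhds 0) := by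
    refine squeeze_zero_norm (a := fun N : ℕ => (∫ t, ‖F 0 t‖) * ((4 * x) ^ N / N.factorial))
      (fun N => ?_) ?_
    · rw [norm_mul, norm_pow, norm_neg, norm_one, one_pow, one_mul, ← integral_mul_const]
      refine norm_integral_le_of_norm_le (hint.norm.mul_const _) (Filter.Eventually.of_forall
        fun t => ?_)
      simp only [hF, norm_mul, Nat.cast_zero, sub_zero, mul_assoc]
      gcongr
      exact norm_besselSqKernel_sub_nat_le hx τ (by simp; linarith) N
    · simpa using (FloorSemiring.tendsto_pow_div_factorial_atTop (4 * x)).const_mul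
        (∫ t, ‖F 0 t‖)
  have h := (tendsto_const_nhds (x := ∫ t : ℝ, (π : ℂ) / Complex.sin (π * (γ + t * Complex.I)) *
        besselSqKernel x τ (γ + t * Complex.I)) (f := Filter.atTop)).sub hrem
  rw [sub_zero] at h
  refine h.congr fun N => ?_
  rw [key N, hF]
  ring

theorem descPochhammer_smeval_mul_Gamma (k : ℕ) {a : ℂ} (h : (k : ℝ) < a.re + 1) :
    (descPochhammer ℤ k).smeval a * Complex.Gamma (a - k + 1) = Complex.Gamma (a + 1) := by
  induction k with
  | zero => simp
  | succ k ih =>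
    push_cast at h
    have hne : a - k ≠ 0 := fun h0 => by
      have := congrArg Complex.re h0
      simp at this
      linarith
    rw [← ih (by linarith), Complex.Gamma_add_one _ hne, descPochhammer_succ_right,
      Polynomial.smeval_mul, Polynomial.smeval_sub, Polynomial.smeval_X, pow_one,
      Polynomial.smeval_natCast]
    push_cast
    rw [show a - (k + 1) + 1 = a - k by ring]
    simp
    ring

theorem choose_eq_Gamma_div (k : ℕ) {a : ℂ} (h : (k : ℝ) < a.re + 1) :
    Ring.choose a k = Complex.Gamma (a + 1) / (k.factorial * Complex.Gamma (a - k + 1)) := by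
  have hne : Complex.Gamma (a - k + 1) ≠ 0 :=
    Complex.Gamma_ne_zero_of_re_pos (by simp; linarith)
  rw [Ring.choose_eq_smul, ← descPochhammer_smeval_mul_Gamma k h, smul_eq_mul]
  field_simp

/-- The Chu–Vandermonde identity in the form that gives the Taylor coefficients of `J_ν²`. -/
theorem sum_antidiagonal_one_div_Gamma (n : ℕ) {ν : ℂ} (hν : ν.re = 0) :
    ∑ p ∈ Finset.HasAntidiagonal.antidiagonal n, 1 / ((p.1.factorial * Complex.Gamma (p.1 + ν + 1)) *
        (p.2.factorial * Complex.Gamma (p.2 + ν + 1))) =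
      Complex.Gamma (2 * n + 2 * ν + 1) /
        (Complex.Gamma (n + ν + 1) ^ 2 * n.factorial * Complex.Gamma (n + 2 * ν + 1)) := by
  have hn : (0 : ℝ) ≤ n := Nat.cast_nonneg n
  have hG : Complex.Gamma (n + ν + 1) ≠ 0 :=
    Complex.Gamma_ne_zero_of_re_pos (by simp [hν]; linarith)
  have h := Ring.add_choose_eq n (Commute.all (n + ν) (n + ν))
  rw [choose_eq_Gamma_div n (by simp [hν]; linarith),
    show (n + ν + (n + ν) + 1 : ℂ) = 2 * n + 2 * ν + 1 by ring,
    show (n + ν + (n + ν) - n + 1 : ℂ) = n + 2 * ν + 1 by ring] at h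
  have h' : ∀ p ∈ Finset.HasAntidiagonal.antidiagonal n, Ring.choose (n + ν) p.1 * Ring.choose (n + ν) p.2 =
      Complex.Gamma (n + ν + 1) ^ 2 * (1 / ((p.1.factorial * Complex.Gamma (p.1 + ν + 1)) *
        (p.2.factorial * Complex.Gamma (p.2 + ν + 1)))) := by
    intro p hp
    have hp' : p.1 + p.2 = n := Finset.HasAntidiagonal.mem_antidiagonal.1 hp
    have hc : (n : ℂ) = p.1 + p.2 := by rw [← hp']; push_cast; ring
    have hr : (n : ℝ) = p.1 + p.2 := by rw [← hp']; push_cast; ring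
    have h1 : (0 : ℝ) ≤ p.1 := Nat.cast_nonneg _
    have h2 : (0 : ℝ) ≤ p.2 := Nat.cast_nonneg _
    rw [choose_eq_Gamma_div p.1 (by simp [hν]; linarith),
      choose_eq_Gamma_div p.2 (by simp [hν]; linarith),
      show (n + ν - p.1 + 1 : ℂ) = p.2 + ν + 1 by rw [hc]; ring,
      show (n + ν - p.2 + 1 : ℂ) = p.1 + ν + 1 by rw [hc]; ring, div_mul_div_comm, mul_one_div]
    congr 1 <;> ring
  rw [Finset.sum_congr rfl h', ← Finset.mul_sum] at h
  rw [← mul_right_inj' (pow_ne_zero 2 hG), ← h]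
  field_simp

theorem sqrt_pi_mul_sum_antidiagonal {x : ℝ} (hx : 0 < x) (τ : ℝ) (n : ℕ) :
    (Real.sqrt π : ℂ) * ∑ p ∈ Finset.HasAntidiagonal.antidiagonal n,
      ((-1 : ℂ) ^ p.1 * ((Real.sqrt x : ℂ) / 2) ^ (2 * (p.1 : ℂ) + Complex.I * τ)) /
        (p.1.factorial * Complex.Gamma (p.1 + Complex.I * τ + 1)) *
      (((-1 : ℂ) ^ p.2 * ((Real.sqrt x : ℂ) / 2) ^ (2 * (p.2 : ℂ) + Complex.I * τ)) /
        (p.2.factorial * Complex.Gamma (p.2 + Complex.I * τ + 1))) =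
      (-1 : ℂ) ^ n * besselSqKernel x τ (-n) := by
  set ν : ℂ := Complex.I * τ with hν
  have hre : ν.re = 0 := by simp [hν]
  have hn : (0 : ℝ) ≤ n := Nat.cast_nonneg n
  have hy : (Real.sqrt x : ℂ) / 2 ≠ 0 := by
    have := (Real.sqrt_pos.2 hx).ne'
    exact div_ne_zero (by exact_mod_cast this) two_ne_zero
  have h' : ∀ p ∈ Finset.HasAntidiagonal.antidiagonal n,
      ((-1 : ℂ) ^ p.1 * ((Real.sqrt x : ℂ) / 2) ^ (2 * (p.1 : ℂ) + ν)) /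
        (p.1.factorial * Complex.Gamma (p.1 + ν + 1)) *
      (((-1 : ℂ) ^ p.2 * ((Real.sqrt x : ℂ) / 2) ^ (2 * (p.2 : ℂ) + ν)) /
        (p.2.factorial * Complex.Gamma (p.2 + ν + 1))) =
      ((-1 : ℂ) ^ n * ((Real.sqrt x : ℂ) / 2) ^ (2 * (n + ν))) *
        (1 / ((p.1.factorial * Complex.Gamma (p.1 + ν + 1)) *
        (p.2.factorial * Complex.Gamma (p.2 + ν + 1)))) := by
    intro p hp
    have hp' : p.1 + p.2 = n := Finset.HasAntidiagonal.mem_antidiagonal.1 hp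
    have e : ((Real.sqrt x : ℂ) / 2) ^ (2 * (((p.1 + p.2 : ℕ) : ℂ) + ν)) =
        ((Real.sqrt x : ℂ) / 2) ^ (2 * (p.1 : ℂ) + ν) *
          ((Real.sqrt x : ℂ) / 2) ^ (2 * (p.2 : ℂ) + ν) := by
      rw [← Complex.cpow_add _ _ hy]
      congr 1
      push_cast
      ring
    rw [← hp', pow_add, e, div_mul_div_comm, mul_one_div]
    congr 1
    ring
  rw [Finset.sum_congr rfl h', ← Finset.mul_sum, sum_antidiagonal_one_div_Gamma n hre]
  have hdup := Complex.Gamma_mul_Gamma_add_half (n + ν + 1 / 2)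
  have hpow : ((Real.sqrt x : ℂ) / 2) ^ (2 * (n + ν)) =
      (x : ℂ) ^ (n + ν) * 2 ^ (1 - 2 * (n + ν + 1 / 2)) := by
    have e1 : ((Real.sqrt x : ℂ) / 2) = ((Real.sqrt x : ℝ) : ℂ) * ((2⁻¹ : ℝ) : ℂ) := by
      push_cast; ring
    have e2 : ((Real.sqrt x : ℝ) : ℂ) ^ (2 * (n + ν)) = (x : ℂ) ^ (n + ν) := by
      have : (x : ℂ) = (Real.sqrt x : ℂ) * (Real.sqrt x : ℂ) := by
        exact_mod_cast (Real.mul_self_sqrt hx.le).symm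
      rw [this, Complex.mul_cpow_ofReal_nonneg (Real.sqrt_nonneg x) (Real.sqrt_nonneg x), two_mul,
        Complex.cpow_add _ _ (by exact_mod_cast (Real.sqrt_pos.2 hx).ne')]
    rw [e1, Complex.mul_cpow_ofReal_nonneg (Real.sqrt_nonneg x) (by norm_num), e2]
    congr 1
    rw [show (1 - 2 * (n + ν + 1 / 2) : ℂ) = -(2 * (n + ν)) by ring, Complex.cpow_neg]
    have := Complex.inv_cpow (2 : ℂ) (2 * (n + ν)) (by
      rw [show (2 : ℂ) = ((2 : ℝ) : ℂ) by norm_num, Complex.arg_ofReal_of_nonneg (by norm_num)]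
      exact Real.pi_pos.ne)
    rw [← this]
    norm_num
  have g1 : Complex.Gamma (n + ν + 1) ≠ 0 :=
    Complex.Gamma_ne_zero_of_re_pos (by simp [hre]; linarith)
  have g2 : Complex.Gamma (n + 2 * ν + 1) ≠ 0 :=
    Complex.Gamma_ne_zero_of_re_pos (by simp [hre]; linarith)
  have g3 : (n.factorial : ℂ) ≠ 0 := by exact_mod_cast n.factorial_ne_zero
  rw [show (n + ν + 1 / 2 + 1 / 2 : ℂ) = n + ν + 1 by ring,
    show (2 * (n + ν + 1 / 2) : ℂ) = 2 * n + 2 * ν + 1 by ring] at hdup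
  rw [show (2 * (n + ν + 1 / 2) : ℂ) = 2 * n + 2 * ν + 1 by ring] at hpow
  rw [besselSqKernel, hpow, ← hν, show (1 / 2 + ν - -n : ℂ) = n + ν + 1 / 2 by ring,
    show (ν - -n : ℂ) = n + ν by ring, show (1 + ν - -n : ℂ) = n + ν + 1 by ring,
    show (1 - -n : ℂ) = n + 1 by ring, show (1 + 2 * ν - -n : ℂ) = n + 2 * ν + 1 by ring,
    Complex.Gamma_nat_eq_factorial]
  generalize Complex.Gamma (n + ν + 1 / 2) = G₀ at *
  generalize Complex.Gamma (n + ν + 1) = G₁ at *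
  generalize Complex.Gamma (n + 2 * ν + 1) = G₂ at *
  generalize Complex.Gamma (2 * n + 2 * ν + 1) = G₃ at *
  generalize (2 : ℂ) ^ (1 - (2 * n + 2 * ν + 1)) = T at *
  field_simp
  linear_combination -(x : ℂ) ^ (n + ν) * hdup

theorem summable_norm_besselJ_term {x : ℝ} (hx : 0 < x) (τ : ℝ) :
    Summable fun k : ℕ => ‖((-1 : ℂ) ^ k * ((Real.sqrt x : ℂ) / 2) ^
      (2 * (k : ℂ) + Complex.I * τ)) / (k.factorial * Complex.Gamma (k + Complex.I * τ + 1))‖ := by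
  set g := ‖Complex.Gamma ((1 : ℝ) + τ * Complex.I)‖ with hg
  have hg0 : 0 < g := norm_pos_iff.2 (Complex.Gamma_ne_zero_of_re_pos (by simp))
  refine Summable.of_nonneg_of_le (fun k => norm_nonneg _) (fun k => ?_)
    ((Real.summable_pow_div_factorial ((Real.sqrt x / 2) ^ 2)).mul_right g⁻¹)
  have hk : (0 : ℝ) ≤ k := Nat.cast_nonneg k
  have hy : 0 < Real.sqrt x / 2 := by have := Real.sqrt_pos.2 hx; positivity
  have hm := norm_Gamma_div_Gamma_mono τ one_pos (show (1 : ℝ) ≤ k + 1 by linarith)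
  rw [Real.Gamma_one, div_one, Real.Gamma_nat_eq_factorial, ← hg] at hm
  have h1 : (1 : ℝ) ≤ k.factorial := by exact_mod_cast Nat.one_le_iff_ne_zero.2 k.factorial_ne_zero
  have hG : g ≤ ‖Complex.Gamma (k + Complex.I * τ + 1)‖ := by
    have e : (k + Complex.I * τ + 1 : ℂ) = ((k + 1 : ℝ) : ℂ) + τ * Complex.I := by push_cast; ring
    rw [e]
    exact hm.trans (div_le_self (norm_nonneg _) h1)
  have hp : ‖((Real.sqrt x : ℂ) / 2) ^ (2 * (k : ℂ) + Complex.I * τ)‖ =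
      ((Real.sqrt x / 2) ^ 2) ^ k := by
    rw [show (Real.sqrt x : ℂ) / 2 = ((Real.sqrt x / 2 : ℝ) : ℂ) by push_cast; ring,
      Complex.norm_cpow_eq_rpow_re_of_pos hy, ← pow_mul, ← Real.rpow_natCast]
    congr 1
    simp
  rw [norm_div, norm_mul, norm_mul, norm_pow, norm_neg, norm_one, one_pow, one_mul, hp,
    Complex.norm_natCast, ← div_eq_mul_inv, div_div]
  gcongr

theorem hasSum_besselSqKernel {x : ℝ} (hx : 0 < x) (τ : ℝ) :
    HasSum (fun n : ℕ => (-1 : ℂ) ^ n * besselSqKernel x τ (-n))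
      (Real.sqrt π * besselJ (Complex.I * τ) (Real.sqrt x) ^ 2) := by
  have hs := summable_norm_besselJ_term hx τ
  have h := (summable_norm_sum_mul_antidiagonal_of_summable_norm hs hs).of_norm.hasSum
  rw [← tsum_mul_tsum_eq_tsum_sum_antidiagonal_of_summable_norm hs hs] at h
  have h' := h.mul_left (Real.sqrt π : ℂ)
  simp only [sqrt_pi_mul_sum_antidiagonal hx τ] at h'
  rw [besselJ, sq]
  exact h'

theorem besselJ_neg_eq_conj {x : ℝ} (hx : 0 < x) (τ : ℝ) :
    besselJ (Complex.I * (-τ : ℝ)) (Real.sqrt x) =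
      (starRingEnd ℂ) (besselJ (Complex.I * τ) (Real.sqrt x)) := by
  rw [besselJ, besselJ, Complex.conj_tsum]
  refine tsum_congr fun k => ?_
  have hy : 0 < Real.sqrt x / 2 := by have := Real.sqrt_pos.2 hx; positivity
  have e : (Real.sqrt x : ℂ) / 2 = ((Real.sqrt x / 2 : ℝ) : ℂ) := by push_cast; ring
  have hc := Complex.cpow_conj ((Real.sqrt x : ℂ) / 2) (2 * (k : ℂ) + Complex.I * τ) (by
    rw [e, Complex.arg_ofReal_of_nonneg hy.le]
    exact Real.pi_pos.ne)
  rw [map_div₀, map_mul, map_mul, ← Complex.Gamma_conj]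
  have e' : (starRingEnd ℂ) ((Real.sqrt x : ℂ) / 2) = (Real.sqrt x : ℂ) / 2 := by
    rw [e, Complex.conj_ofReal]
  rw [e'] at hc
  rw [← hc]
  simp [Complex.conj_ofNat]

theorem mellinBarnesRatio_mul_cpow {x : ℝ} (τ : ℝ) {γ : ℝ} (h0 : 0 < γ) (h1 : γ < 1 / 2)
    (t : ℝ) :
    mellinBarnesRatio γ τ t * (x : ℂ) ^ (-((γ : ℂ) + t * Complex.I)) =
      1 / (2 * (Real.cosh (π * τ) : ℂ)) *
        ((π : ℂ) / Complex.sin (π * (γ + (t + τ : ℝ) * Complex.I)) *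
            besselSqKernel x τ (γ + (t + τ : ℝ) * Complex.I) +
          (π : ℂ) / Complex.sin (π * (γ + (t + -τ : ℝ) * Complex.I)) *
            besselSqKernel x (-τ) (γ + (t + -τ : ℝ) * Complex.I)) := by
  set s : ℂ := γ + t * Complex.I with hs
  have hsre : s.re = γ := by simp [hs]
  have hne : ∀ w : ℂ, 0 < w.re → Complex.Gamma w ≠ 0 := fun w hw =>
    Complex.Gamma_ne_zero_of_re_pos hw
  have e1 : (γ : ℂ) + (t + τ : ℝ) * Complex.I = s + Complex.I * τ := by
    rw [hs]; push_cast; ring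
  have e2 : (γ : ℂ) + (t + -τ : ℝ) * Complex.I = s - Complex.I * τ := by
    rw [hs]; push_cast; ring
  have s0 : Complex.sin (π * s) ≠ 0 := by
    rw [hs]; exact sin_pi_mul_vertical_ne_zero h0 (by linarith) t
  have s1 : Complex.sin (π * (s + Complex.I * τ)) ≠ 0 := by
    rw [← e1]; exact sin_pi_mul_vertical_ne_zero h0 (by linarith) _
  have s2 : Complex.sin (π * (s - Complex.I * τ)) ≠ 0 := by
    rw [← e2]; exact sin_pi_mul_vertical_ne_zero h0 (by linarith) _
  have hc : (Real.cosh (π * τ) : ℂ) ≠ 0 := by exact_mod_cast (Real.cosh_pos _).ne'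
  have hadd : Complex.sin (π * (s + Complex.I * τ)) + Complex.sin (π * (s - Complex.I * τ)) =
      2 * Complex.sin (π * s) * (Real.cosh (π * τ) : ℂ) := by
    rw [mul_add, mul_sub, Complex.sin_add, Complex.sin_sub, Complex.ofReal_cosh,
      ← Complex.cos_mul_I]
    push_cast
    rw [show (π : ℂ) * (Complex.I * τ) = π * τ * Complex.I by ring]
    ring
  have r0 := Complex.Gamma_mul_Gamma_one_sub s
  have r1 := Complex.Gamma_mul_Gamma_one_sub (s + Complex.I * τ)
  have r2 := Complex.Gamma_mul_Gamma_one_sub (s - Complex.I * τ)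
  have n0 := hne (1 - s) (by simp [hsre]; linarith)
  have n1 := hne (1 - (s + Complex.I * τ)) (by simp [hsre]; linarith)
  have n2 := hne (1 - (s - Complex.I * τ)) (by simp [hsre]; linarith)
  rw [← eq_div_iff n0] at r0
  rw [← eq_div_iff n1] at r1
  rw [← eq_div_iff n2] at r2
  rw [mellinBarnesRatio, ← hs, e1, e2, besselSqKernel, besselSqKernel, r0, r1, r2,
    Complex.ofReal_neg,
    show 1 / 2 + Complex.I * τ - (s + Complex.I * τ) = 1 / 2 - s by ring,
    show 1 + Complex.I * τ - (s + Complex.I * τ) = 1 - s by ring,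
    show Complex.I * τ - (s + Complex.I * τ) = -s by ring,
    show 1 + 2 * (Complex.I * τ) - (s + Complex.I * τ) = 1 - (s - Complex.I * τ) by ring,
    show 1 / 2 + Complex.I * -τ - (s - Complex.I * τ) = 1 / 2 - s by ring,
    show 1 + Complex.I * -τ - (s - Complex.I * τ) = 1 - s by ring,
    show Complex.I * -τ - (s - Complex.I * τ) = -s by ring,
    show 1 + 2 * (Complex.I * -τ) - (s - Complex.I * τ) = 1 - (s + Complex.I * τ) by ring]
  have hpi : (π : ℂ) ≠ 0 := by exact_mod_cast Real.pi_pos.ne'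
  set A := Complex.sin (π * s)
  set B := Complex.sin (π * (s + Complex.I * τ))
  set D := Complex.sin (π * (s - Complex.I * τ))
  generalize Complex.Gamma (1 / 2 - s) = G
  field_simp
  linear_combination (-1 : ℂ) * G * (x : ℂ) ^ (-s) * hadd

/-- For every `x > 0`, real `τ` and `γ ∈ (0, 1/4)`, the kernel `Φ_τ(x)` admits the
absolutely convergent Mellin–Barnes representation
`Φ_τ(x) = (1/(2πi)) ∫_{γ−i∞}^{γ+i∞} Γ(s+iτ)Γ(s−iτ)Γ(1/2−s)/(Γ(s)Γ(1−s)²) x^{−s} ds`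
(the line integral is written as `(1/(2π)) ∫_{t ∈ ℝ}` after substituting `s = γ + it`). -/
theorem Phi_mellinBarnes_rep (x τ γ : ℝ) (hx : 0 < x) (hγ : 0 < γ) (hγ' : γ < 1 / 4) :
    MeasureTheory.Integrable
        (fun t : ℝ => mellinBarnesRatio γ τ t * (x : ℂ) ^ (-((γ : ℂ) + t * Complex.I))) ∧
      (Phi τ x : ℂ) = (1 / (2 * (π : ℂ))) *
        ∫ t : ℝ, mellinBarnesRatio γ τ t * (x : ℂ) ^ (-((γ : ℂ) + t * Complex.I)) := by
  have hI := fun σ : ℝ => by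
    have h := integrable_pi_div_sin_mul_besselSqKernel hx σ hγ hγ' 0
    simp only [Nat.cast_zero, sub_zero] at h
    exact h
  have hS := fun σ : ℝ => tendsto_nhds_unique (tendsto_sum_besselSqKernel hx σ hγ hγ')
    ((hasSum_besselSqKernel hx σ).tendsto_sum_nat.const_mul (2 * (π : ℂ)))
  simp only [mellinBarnesRatio_mul_cpow τ hγ (show γ < 1 / 2 by linarith)]
  have h1 := (hI τ).comp_add_right τ
  have h2 := (hI (-τ)).comp_add_right (-τ)
  refine ⟨(h1.add h2).const_mul _, ?_⟩
  have hJ := Complex.add_conj (besselJ (Complex.I * τ) (Real.sqrt x) ^ 2)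
  have hpi : (π : ℂ) ≠ 0 := by exact_mod_cast Real.pi_pos.ne'
  rw [integral_const_mul, integral_add h1 h2,
    integral_add_right_eq_self (fun t : ℝ => (π : ℂ) / Complex.sin (π * (γ + t * Complex.I)) *
      besselSqKernel x τ (γ + t * Complex.I)),
    integral_add_right_eq_self (fun t : ℝ => (π : ℂ) / Complex.sin (π * (γ + t * Complex.I)) *
      besselSqKernel x (-τ) (γ + t * Complex.I)), hS, hS, besselJ_neg_eq_conj hx, Phi, ← map_pow,
    ← mul_add, ← mul_add, hJ]
  push_cast
  field_simp
end

section
/- For every complex number s with Re s > 0 and every real y, the Fourier cosine integral formula ∫_0^∞ Γ(s+iτ)Γ(s−iτ) cos(τy) dτ = (π / 2^{2s}) · Γ(2s) / cosh^{2s}(y/2) holds, and reciprocally Γ(s+iτ)Γ(s−iτ) = (Γ(2s)/2^{2s−1}) ∫_0^∞ cos(τy)/cosh^{2s}(y/2) dy for every real τ. -/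
open Complex MeasureTheory Real Set FourierTransform

lemma ofReal_exp_cpow (r : ℝ) (z : ℂ) : ((Real.exp r : ℝ) : ℂ) ^ z = cexp (r * z) := by
  rw [cpow_def_of_ne_zero (by exact_mod_cast (Real.exp_pos r).ne'), ← ofReal_log (Real.exp_pos r).le,
    Real.log_exp]

lemma Real.sigmoid_eq_exp_sub_log (u : ℝ) :
    Real.sigmoid u = Real.exp (u / 2 - Real.log (2 * Real.cosh (u / 2))) := by
  have hc : 0 < 2 * Real.cosh (u / 2) := by have := Real.cosh_pos (u / 2); positivity
  have h1 : Real.exp (u / 2) * Real.exp (-(u / 2)) = 1 := by rw [← Real.exp_add]; simp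
  have h2 : Real.exp (-u) = Real.exp (-(u / 2)) * Real.exp (-(u / 2)) := by
    rw [← Real.exp_add]; ring_nf
  rw [Real.exp_sub, Real.exp_log hc, Real.sigmoid_def, Real.cosh_eq, h2,
    inv_eq_one_div, div_eq_div_iff (by positivity) (by positivity)]
  linear_combination (-Real.exp (-(u / 2))) * h1

lemma ofReal_cosh_cpow (s : ℂ) (u : ℝ) :
    (2 : ℂ) ^ (2 * s) * ((Real.cosh (u / 2) : ℂ)) ^ (2 * s) =
      cexp (Real.log (2 * Real.cosh (u / 2)) * (2 * s)) := by
  have hc : 0 < 2 * Real.cosh (u / 2) := by have := Real.cosh_pos (u / 2); positivity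
  rw [← ofReal_exp_cpow, Real.exp_log hc]
  have := mul_cpow_ofReal_nonneg (a := 2) (by norm_num) (Real.cosh_pos (u / 2)).le (2 * s)
  rw [ofReal_mul, this]
  norm_num

/-- The Beta integrand after the substitution `x = sigmoid u`. -/
lemma abs_deriv_sigmoid_smul_beta_integrand (s : ℂ) (τ u : ℝ) :
    |Real.sigmoid u * (1 - Real.sigmoid u)| •
        (((Real.sigmoid u : ℝ) : ℂ) ^ (s + I * τ - 1) *
          (1 - ((Real.sigmoid u : ℝ) : ℂ)) ^ (s - I * τ - 1)) =
      ((2 : ℂ) ^ (2 * s))⁻¹ *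
        (cexp (I * τ * u) / ((Real.cosh (u / 2) : ℂ)) ^ (2 * s)) := by
  have e : ((2 : ℂ) ^ (2 * s))⁻¹ * (cexp (I * τ * u) / ((Real.cosh (u / 2) : ℂ)) ^ (2 * s)) =
      cexp (I * τ * u) / ((2 : ℂ) ^ (2 * s) * ((Real.cosh (u / 2) : ℂ)) ^ (2 * s)) := by
    rw [div_mul_eq_div_div_swap, inv_mul_eq_div]
  have h1 : (1 : ℂ) - ((Real.sigmoid u : ℝ) : ℂ) = ((Real.sigmoid (-u) : ℝ) : ℂ) := by
    rw [Real.sigmoid_neg]; push_cast; rfl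
  rw [e, ofReal_cosh_cpow, h1, ← Real.sigmoid_neg,
    abs_of_pos (mul_pos (Real.sigmoid_pos _) (Real.sigmoid_pos _)), real_smul,
    Real.sigmoid_eq_exp_sub_log u, Real.sigmoid_eq_exp_sub_log (-u), neg_div, Real.cosh_neg,
    ofReal_exp_cpow, ofReal_exp_cpow, ← Real.exp_add, ofReal_exp, ← Complex.exp_add,
    ← Complex.exp_add, ← Complex.exp_sub]
  congr 1
  push_cast
  ring

lemma betaIntegral_add_sub_eq_integral_cosh (s : ℂ) (hs : 0 < s.re) (τ : ℝ) :
    Integrable (fun u : ℝ ↦ cexp (I * τ * u) / ((Real.cosh (u / 2) : ℂ)) ^ (2 * s)) ∧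
    betaIntegral (s + I * τ) (s - I * τ) = ((2 : ℂ) ^ (2 * s))⁻¹ *
      ∫ u : ℝ, cexp (I * τ * u) / ((Real.cosh (u / 2) : ℂ)) ^ (2 * s) := by
  have ha : 0 < (s + I * τ).re := by simpa using hs
  have hb : 0 < (s - I * τ).re := by simpa using hs
  have hd : ∀ x ∈ (univ : Set ℝ),
      HasDerivWithinAt Real.sigmoid (Real.sigmoid x * (1 - Real.sigmoid x)) univ x :=
    fun x _ ↦ (Real.hasDerivAt_sigmoid x).hasDerivWithinAt
  have hi : InjOn Real.sigmoid univ := Real.sigmoid_injective.injOn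
  have him : Real.sigmoid '' univ = Ioo 0 1 := by rw [image_univ, Real.range_sigmoid]
  have hne : ((2 : ℂ) ^ (2 * s))⁻¹ ≠ 0 := inv_ne_zero (by simp [cpow_eq_zero_iff])
  constructor
  · have h := betaIntegral_convergent ha hb
    rw [intervalIntegrable_iff_integrableOn_Ioo_of_le zero_le_one, ← him,
      integrableOn_image_iff_integrableOn_abs_deriv_smul MeasurableSet.univ hd hi] at h
    simp only [abs_deriv_sigmoid_smul_beta_integrand, integrableOn_univ] at h
    exact (integrable_const_mul_iff (isUnit_iff_ne_zero.2 hne) _).1 h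
  · rw [betaIntegral, intervalIntegral.integral_of_le zero_le_one, integral_Ioc_eq_integral_Ioo,
      ← him, integral_image_eq_integral_abs_deriv_smul MeasurableSet.univ hd hi]
    simp only [abs_deriv_sigmoid_smul_beta_integrand, setIntegral_univ]
    rw [integral_const_mul]

lemma Gamma_add_mul_Gamma_sub_eq_integral (s : ℂ) (hs : 0 < s.re) (τ : ℝ) :
    Gamma (s + I * τ) * Gamma (s - I * τ) = Gamma (2 * s) * ((2 : ℂ) ^ (2 * s))⁻¹ *
      ∫ u : ℝ, cexp (I * τ * u) / ((Real.cosh (u / 2) : ℂ)) ^ (2 * s) := by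
  rw [Gamma_mul_Gamma_eq_betaIntegral (by simpa using hs) (by simpa using hs),
    (betaIntegral_add_sub_eq_integral_cosh s hs τ).2]
  ring_nf

/-- The Fourier integral of an even function is twice a cosine integral over `(0, ∞)`. -/
lemma integral_cexp_mul_eq_two_mul_integral_cos {f : ℝ → ℂ} (hf : Integrable f)
    (heven : ∀ x, f (-x) = f x) (y : ℝ) :
    ∫ x : ℝ, cexp (I * y * x) * f x = 2 * ∫ x in Ioi (0 : ℝ), f x * (Real.cos (x * y) : ℂ) := by
  have hb (c : ℝ) : Integrable (fun x : ℝ ↦ cexp (I * c * x) * f x) := by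
    refine hf.bdd_mul (c := 1) (by fun_prop) (.of_forall fun x ↦ ?_)
    rw [show I * c * x = ((c * x : ℝ) : ℂ) * I by push_cast; ring, norm_exp_ofReal_mul_I]
  rw [← intervalIntegral.integral_Iic_add_Ioi (b := 0) (hb y).integrableOn (hb y).integrableOn]
  have h := integral_comp_neg_Iic (0 : ℝ) (fun x : ℝ ↦ cexp (I * (-y : ℝ) * x) * f x)
  simp only [heven, neg_zero] at h
  have h' : ∀ x : ℝ, cexp (I * (-y : ℝ) * (-x : ℝ)) = cexp (I * y * x) := by
    intro x; congr 1; push_cast; ring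
  simp only [h'] at h
  rw [h, ← integral_add (hb _).integrableOn (hb _).integrableOn, ← integral_const_mul]
  congr 1 with x
  rw [ofReal_cos, Complex.cos]
  push_cast
  ring_nf

lemma continuous_Gamma_add_mul_Gamma_sub (s : ℂ) (hs : 0 < s.re) :
    Continuous fun τ : ℝ ↦ Gamma (s + I * τ) * Gamma (s - I * τ) := by
  have h : ∀ z : ℂ, 0 < z.re → ContinuousAt Complex.Gamma z := fun z hz ↦
    (differentiableAt_Gamma z fun m hm ↦ by
      rw [hm] at hz; simp at hz; linarith [m.cast_nonneg (α := ℝ)]).continuousAt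
  refine continuous_iff_continuousAt.2 fun τ ↦ ContinuousAt.mul ?_ ?_
  · exact ContinuousAt.comp (f := fun τ : ℝ ↦ s + I * τ) (h _ (by simpa using hs)) (by fun_prop)
  · exact ContinuousAt.comp (f := fun τ : ℝ ↦ s - I * τ) (h _ (by simpa using hs)) (by fun_prop)

lemma integrable_inv_sq_add_sq {a : ℝ} (ha : 0 < a) (t : ℝ) :
    Integrable fun x : ℝ ↦ (a ^ 2 + (t + x) ^ 2)⁻¹ := by
  have h := ((integrable_inv_one_add_sq.comp_mul_left' (inv_ne_zero ha.ne')).comp_add_left t).const_mul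
    ((a ^ 2)⁻¹)
  refine h.congr (.of_forall fun x ↦ ?_)
  simp only
  rw [← mul_inv]
  congr 1
  field_simp

lemma integrable_Gamma_add_mul_Gamma_sub (s : ℂ) (hs : 0 < s.re) :
    Integrable fun τ : ℝ ↦ Gamma (s + I * τ) * Gamma (s - I * τ) := by
  have hs1 : 0 < (s + 1).re := by simp; linarith
  obtain ⟨C, hC⟩ : ∃ C : ℝ, ∀ τ : ℝ, ‖Gamma (s + 1 + I * τ) * Gamma (s + 1 - I * τ)‖ ≤ C := by
    refine ⟨‖Gamma (2 * (s + 1)) * ((2 : ℂ) ^ (2 * (s + 1)))⁻¹‖ *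
      ∫ u : ℝ, ‖(1 : ℂ) / ((Real.cosh (u / 2) : ℂ)) ^ (2 * (s + 1))‖, fun τ ↦ ?_⟩
    rw [Gamma_add_mul_Gamma_sub_eq_integral _ hs1, norm_mul]
    refine mul_le_mul_of_nonneg_left ((norm_integral_le_integral_norm _).trans_eq ?_)
      (norm_nonneg _)
    congr 1 with u
    rw [norm_div, norm_div, show I * τ * u = ((τ * u : ℝ) : ℂ) * I by push_cast; ring,
      norm_exp_ofReal_mul_I, norm_one]
  have hC0 : 0 ≤ C := (norm_nonneg _).trans (hC 0)
  have hg := ((integrable_inv_sq_add_sq hs s.im).add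
    ((integrable_inv_sq_add_sq hs (-s.im)))).const_mul C
  refine hg.mono' (continuous_Gamma_add_mul_Gamma_sub s hs).aestronglyMeasurable
    (.of_forall fun τ ↦ ?_)
  have hn1 : 0 < ‖s + I * τ‖ := norm_pos_iff.2 fun h ↦ by
    have := congrArg Complex.re h; simp at this; linarith
  have hn2 : 0 < ‖s - I * τ‖ := norm_pos_iff.2 fun h ↦ by
    have := congrArg Complex.re h; simp at this; linarith
  have q1 : ‖s + I * τ‖ ^ 2 = s.re ^ 2 + (s.im + τ) ^ 2 := by
    rw [Complex.sq_norm, normSq_apply]; simp; ring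
  have q2 : ‖s - I * τ‖ ^ 2 = s.re ^ 2 + (-s.im + τ) ^ 2 := by
    rw [Complex.sq_norm, normSq_apply]; simp; ring
  have hrec : ‖s + I * τ‖ * ‖s - I * τ‖ * ‖Gamma (s + I * τ) * Gamma (s - I * τ)‖ ≤ C := by
    have := hC τ
    rw [show s + 1 + I * τ = s + I * τ + 1 by ring, show s + 1 - I * τ = s - I * τ + 1 by ring,
      Gamma_add_one _ (norm_pos_iff.1 hn1), Gamma_add_one _ (norm_pos_iff.1 hn2)] at this
    refine le_trans (le_of_eq ?_) this
    simp only [norm_mul]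
    ring
  simp only [Pi.add_apply]
  rw [← q1, ← q2]
  set a := ‖s + I * τ‖
  set b := ‖s - I * τ‖
  calc _ ≤ C * (a⁻¹ * b⁻¹) := by
        rw [← mul_inv, ← div_eq_mul_inv, le_div_iff₀ (by positivity)]
        linarith
    _ ≤ _ := by
        refine mul_le_mul_of_nonneg_left ?_ hC0
        rw [← inv_pow, ← inv_pow]
        nlinarith [sq_nonneg (a⁻¹ - b⁻¹), sq_nonneg (a⁻¹), sq_nonneg (b⁻¹)]

lemma cosh_cpow_ne_zero (s : ℂ) (u : ℝ) : ((Real.cosh (u / 2) : ℂ)) ^ (2 * s) ≠ 0 := by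
  have h : ((Real.cosh (u / 2) : ℝ) : ℂ) ≠ 0 := by exact_mod_cast (Real.cosh_pos _).ne'
  simp only [ne_eq, cpow_eq_zero_iff, h, false_and, not_false_eq_true]

lemma continuous_inv_cosh_cpow (s : ℂ) :
    Continuous fun u : ℝ ↦ (1 : ℂ) / ((Real.cosh (u / 2) : ℂ)) ^ (2 * s) := by
  refine continuous_const.div ?_ (cosh_cpow_ne_zero s)
  refine Continuous.cpow (by fun_prop) continuous_const fun u ↦ ?_
  exact ofReal_mem_slitPlane.2 (Real.cosh_pos _)

lemma integrable_inv_cosh_cpow (s : ℂ) (hs : 0 < s.re) :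
    Integrable fun u : ℝ ↦ (1 : ℂ) / ((Real.cosh (u / 2) : ℂ)) ^ (2 * s) := by
  simpa using (betaIntegral_add_sub_eq_integral_cosh s hs 0).1

/-- Fourier inversion of the Beta integral representation of `Γ(s + iτ) Γ(s - iτ)`. -/
lemma integral_cexp_mul_Gamma_add_mul_Gamma_sub (s : ℂ) (hs : 0 < s.re) (y : ℝ) :
    ∫ τ : ℝ, cexp (I * y * τ) * (Gamma (s + I * τ) * Gamma (s - I * τ)) =
      2 * π * (Gamma (2 * s) * ((2 : ℂ) ^ (2 * s))⁻¹) *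
        (1 / ((Real.cosh (y / 2) : ℂ)) ^ (2 * s)) := by
  set K : ℂ := Gamma (2 * s) * ((2 : ℂ) ^ (2 * s))⁻¹ with hK
  have hK0 : K ≠ 0 := mul_ne_zero (Gamma_ne_zero_of_re_pos (by simpa using hs))
    (inv_ne_zero (by simp [cpow_eq_zero_iff]))
  set g : ℝ → ℂ := fun u ↦ (1 : ℂ) / ((Real.cosh (u / 2) : ℂ)) ^ (2 * s) with hg
  set G : ℝ → ℂ := fun τ ↦ Gamma (s + I * τ) * Gamma (s - I * τ) with hG
  have hF : 𝓕 g = fun w : ℝ ↦ K⁻¹ * G (2 * π * w) := by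
    ext w
    have h := Gamma_add_mul_Gamma_sub_eq_integral s hs (-(2 * π * w))
    rw [eq_inv_mul_iff_mul_eq₀ hK0, fourier_real_eq_integral_exp_smul]
    have : G (2 * π * w) = G (-(2 * π * w)) := by
      simp only [hG]
      push_cast
      rw [mul_comm]
      congr 2 <;> ring
    rw [this]
    simp only [hG]
    rw [h, ← hK]
    congr 2 with u
    rw [smul_eq_mul, hg, mul_one_div]
    congr 2
    push_cast
    ring
  have hGi : Integrable G := integrable_Gamma_add_mul_Gamma_sub s hs
  have hFi : Integrable (𝓕 g) := by
    rw [hF]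
    exact (hGi.comp_mul_left' (by positivity : (2 * π : ℝ) ≠ 0)).const_mul _
  have hinv := congrFun ((continuous_inv_cosh_cpow s).fourierInv_fourier_eq
    (integrable_inv_cosh_cpow s hs) hFi) y
  rw [fourierInv_eq', show 𝓕 (fun u : ℝ ↦ (1 : ℂ) / ((Real.cosh (u / 2) : ℂ)) ^ (2 * s)) = _
    from hF] at hinv
  have hcv := Measure.integral_comp_mul_left (fun τ : ℝ ↦ cexp (I * y * τ) * G τ) (2 * π)
  have hcong : ∀ w : ℝ, cexp (↑(2 * π * inner ℝ w y) * I) • (K⁻¹ * G (2 * π * w)) =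
      K⁻¹ * (cexp (I * y * (2 * π * w : ℝ)) * G (2 * π * w)) := by
    intro w
    rw [smul_eq_mul, mul_left_comm]
    congr 3
    simp
    ring
  simp only [hcong] at hinv
  rw [integral_const_mul, hcv, inv_mul_eq_iff_eq_mul₀ hK0, abs_of_pos (by positivity), real_smul]
    at hinv
  rw [mul_assoc (2 * π : ℂ), ← hinv]
  push_cast
  rw [mul_inv_cancel_left₀ (by simp)]

/-- For every complex `s` with `Re s > 0` and every real `y`,
`∫_0^∞ Γ(s+iτ)Γ(s−iτ) cos(τy) dτ = (π/2^{2s}) Γ(2s)/cosh^{2s}(y/2)`, and reciprocally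
`Γ(s+iτ)Γ(s−iτ) = (Γ(2s)/2^{2s−1}) ∫_0^∞ cos(τu)/cosh^{2s}(u/2) du` for every real `τ`. -/
theorem gamma_product_fourier_cosine (s : ℂ) (hs : 0 < s.re) :
    (∀ y : ℝ,
      (∫ τ in Set.Ioi (0 : ℝ),
          Complex.Gamma (s + Complex.I * τ) * Complex.Gamma (s - Complex.I * τ) *
            (Real.cos (τ * y) : ℂ)) =
        (π : ℂ) / (2 : ℂ) ^ (2 * s) * Complex.Gamma (2 * s) /
          ((Real.cosh (y / 2) : ℂ)) ^ (2 * s)) ∧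
    (∀ τ : ℝ,
      Complex.Gamma (s + Complex.I * τ) * Complex.Gamma (s - Complex.I * τ) =
        Complex.Gamma (2 * s) / (2 : ℂ) ^ (2 * s - 1) *
          ∫ u in Set.Ioi (0 : ℝ),
            (Real.cos (τ * u) : ℂ) / ((Real.cosh (u / 2) : ℂ)) ^ (2 * s)) := by
  constructor
  · intro y
    have h := integral_cexp_mul_eq_two_mul_integral_cos
      (integrable_Gamma_add_mul_Gamma_sub s hs) (fun x ↦ by
        rw [mul_comm]; push_cast; congr 2 <;> ring) y
    rw [integral_cexp_mul_Gamma_add_mul_Gamma_sub s hs] at h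
    refine mul_left_cancel₀ two_ne_zero (h.symm.trans ?_)
    ring
  · intro τ
    have h := integral_cexp_mul_eq_two_mul_integral_cos
      (integrable_inv_cosh_cpow s hs) (fun x ↦ by
        rw [neg_div, Real.cosh_neg]) τ
    simp only [mul_one_div, one_div_mul_eq_div] at h
    rw [Gamma_add_mul_Gamma_sub_eq_integral s hs, h, cpow_sub _ _ two_ne_zero, cpow_one]
    field_simp
    simp only [mul_comm τ]
end
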